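/- Let k ≥ 1 and A ≥ 2 be integers with A ≤ binom(2k,k)/(2k), and let f:ℝ→ℝ be supported on (−∞,1] with f ∈ C^A(ℝ) and f, f′, …, f^{(A)} all uniformly bounded. Then there is a constant C(k,f) > 0 such that for all x ≥ R ≥ 2, Σ_{n ≤ x} M_f(n;R)^{2k} ≤ C(k,f)·x·(log R)^{binom(2k,k) − 2kA}. -/

import Mathlib

open scoped Classical

/-- `M_f(n;R) := Σ_{d | n} μ(d) f(log d / log R)`. -/
noncomputable def Mf (f : ℝ → ℝ) (n : ℕ) (R : ℝ) : ℝ :=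
  ∑ d ∈ n.divisors,
    ((ArithmeticFunction.moebius d : ℤ) : ℝ) * f (Real.log d / Real.log R)

theorem norm_natCast_cpow_sub_telescope_le {s : ℂ} (hs : 1 < s.re) {m : ℕ} (hm : 1 ≤ m) :
    ‖((m + 1 : ℕ) : ℂ) ^ (-s) -
      ((m : ℂ) ^ (1 - s) - ((m + 1 : ℕ) : ℂ) ^ (1 - s)) / (s - 1)‖ ≤ ‖s‖ / (m : ℝ) ^ 2 := by
  have hm0 : (0 : ℝ) < m := by exact_mod_cast hm
  have hs1 : (1 - s) ≠ 0 := by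
    intro h
    have := congrArg Complex.re h
    simp at this
    linarith
  have hconv : Convex ℝ (Set.Icc (m : ℝ) (m + 1)) := convex_Icc _ _
  have hd : ∀ (r : ℂ), r ≠ 0 → ∀ x ∈ Set.Icc (m : ℝ) (m + 1),
      HasDerivWithinAt (fun y : ℝ => (y : ℂ) ^ r) (r * (x : ℂ) ^ (r - 1))
        (Set.Icc (m : ℝ) (m + 1)) x := by
    intro r hr x hx
    have hx0 : (0 : ℝ) < x := lt_of_lt_of_le hm0 hx.1
    have h := hasDerivAt_ofReal_cpow_const' (x := x) hx0.ne' (r := r - 1) (by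
      intro h; apply hr; linear_combination h)
    simp only [sub_add_cancel] at h
    have h2 := h.const_mul r
    refine (h2.congr_deriv rfl).hasDerivWithinAt.congr_of_eventuallyEq ?_ ?_
    · refine Filter.Eventually.of_forall fun y => ?_
      field_simp
    · field_simp
  have hs0 : -s ≠ 0 := by
    intro h
    have := congrArg Complex.re h
    simp at this
    linarith
  have hstep : ∀ x ∈ Set.Icc (m : ℝ) (m + 1),
      ‖(x : ℂ) ^ (-s) - ((m + 1 : ℝ) : ℂ) ^ (-s)‖ ≤ ‖s‖ / (m : ℝ) ^ 2 := by
    intro x hx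
    have := hconv.norm_image_sub_le_of_norm_hasDerivWithin_le (hd (-s) hs0)
      (C := ‖s‖ / (m : ℝ) ^ 2) (fun y hy => ?_) (x := (m : ℝ) + 1) (y := x) (by simp) hx
    · refine this.trans ?_
      have : ‖x - (m + 1)‖ ≤ 1 := by
        rw [Real.norm_eq_abs, abs_le]
        constructor <;> linarith [hx.1, hx.2]
      exact mul_le_of_le_one_right (by positivity) this
    · have hy0 : (0 : ℝ) < y := lt_of_lt_of_le hm0 hy.1
      rw [norm_mul, norm_neg, Complex.norm_cpow_eq_rpow_re_of_pos hy0, div_eq_mul_inv]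
      gcongr
      rw [← Real.rpow_natCast, ← Real.rpow_neg hm0.le]
      have h1y : (1 : ℝ) ≤ m := by exact_mod_cast hm
      simp only [Complex.sub_re, Complex.neg_re, Complex.one_re]
      calc y ^ (-s.re - 1) ≤ (m : ℝ) ^ (-s.re - 1) :=
            Real.rpow_le_rpow_of_nonpos hm0 hy.1 (by linarith)
        _ ≤ _ := Real.rpow_le_rpow_of_exponent_le h1y (by push_cast; linarith)
  have key := hconv.norm_image_sub_le_of_norm_hasDerivWithin_le
      (f := fun y : ℝ => (y : ℂ) ^ (1 - s) / (1 - s) - (y : ℂ) * ((m + 1 : ℝ) : ℂ) ^ (-s))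
      (f' := fun x : ℝ => (x : ℂ) ^ (-s) - ((m + 1 : ℝ) : ℂ) ^ (-s))
      (C := ‖s‖ / (m : ℝ) ^ 2) (fun x hx => ?_) hstep (x := (m : ℝ)) (y := (m : ℝ) + 1)
      (by simp) (by simp)
  · simp only [add_sub_cancel_left, norm_one, mul_one] at key
    rw [← norm_neg]
    refine le_of_eq_of_le (congrArg norm ?_) key
    have : s - 1 ≠ 0 := by
      intro h; apply hs1; linear_combination -h
    have h4 : ((m : ℂ) + 1) ^ (1 - s) = ((m : ℂ) + 1) * ((m : ℂ) + 1) ^ (-s) := by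
      have h5 : (m : ℂ) + 1 ≠ 0 := by exact_mod_cast Nat.succ_ne_zero m
      rw [show 1 - s = 1 + -s by ring, Complex.cpow_add _ _ h5, Complex.cpow_one]
    have h6 (a : ℂ) : a / (1 - s) = -(a / (s - 1)) := by
      rw [← div_neg, neg_sub]
    push_cast
    rw [h6, h6, h4]
    ring
  · have h1 := (hd (1 - s) hs1 x hx).div_const (1 - s)
    have h2 : HasDerivWithinAt (fun y : ℝ => (y : ℂ)) 1 (Set.Icc (m : ℝ) (m + 1)) x :=
      (Complex.ofRealCLM.hasDerivAt (x := x)).hasDerivWithinAt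
    have h3 := h1.sub (h2.mul_const (((m + 1 : ℝ) : ℂ) ^ (-s)))
    refine h3.congr_deriv ?_
    rw [mul_div_cancel_left₀ _ hs1, one_mul]
    ring_nf

theorem sum_inv_sq_Ico_le {N : ℕ} (hN : 1 ≤ N) (M : ℕ) :
    ∑ m ∈ Finset.Ico N M, ((m : ℝ) ^ 2)⁻¹ ≤ 2 / N := by
  obtain ⟨k, rfl⟩ := Nat.exists_eq_add_of_le' hN
  have := sum_Ioo_inv_sq_le (α := ℝ) k M
  rw [Finset.Ico_add_one_left_eq_Ioo]
  simpa using this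

theorem norm_riemannZeta_sub_partial_sum_le {s : ℂ} (hs : 1 < s.re) {N : ℕ} (hN : 1 ≤ N) :
    ‖riemannZeta s - (∑ n ∈ Finset.Icc 1 N, (n : ℂ) ^ (-s) + (N : ℂ) ^ (1 - s) / (s - 1))‖
      ≤ 2 * ‖s‖ / N := by
  have hsum : HasSum (fun n : ℕ => (n : ℂ) ^ (-s)) (riemannZeta s) := by
    have h := zeta_eq_tsum_one_div_nat_cpow hs
    have h2 : Summable (fun n : ℕ => 1 / (n : ℂ) ^ s) := Complex.summable_one_div_nat_cpow.mpr hs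
    have h3 := h2.hasSum
    rw [← h] at h3
    simpa [Complex.cpow_neg] using h3
  have hs0 : -s ≠ 0 := by
    intro h
    have := congrArg Complex.re h
    simp at this
    linarith
  have ht1 : Filter.Tendsto (fun M : ℕ => ∑ n ∈ Finset.range (M + 1), (n : ℂ) ^ (-s))
      Filter.atTop (nhds (riemannZeta s)) :=
    hsum.tendsto_sum_nat.comp (Filter.tendsto_add_atTop_nat 1)
  have ht2 : Filter.Tendsto (fun M : ℕ => (M : ℂ) ^ (1 - s) / (s - 1))
      Filter.atTop (nhds 0) := by
    rw [← zero_div (s - 1)]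
    apply Filter.Tendsto.div_const
    rw [tendsto_zero_iff_norm_tendsto_zero]
    have h := (tendsto_rpow_neg_atTop (y := s.re - 1) (by linarith)).comp
      tendsto_natCast_atTop_atTop
    refine h.congr' ?_
    filter_upwards [Filter.eventually_gt_atTop 0] with M hM
    simp only [Function.comp]
    rw [← Complex.ofReal_natCast, Complex.norm_cpow_eq_rpow_re_of_pos (by exact_mod_cast hM)]
    simp
  have hfin : ∀ M : ℕ, N ≤ M → ‖(∑ n ∈ Finset.range (M + 1), (n : ℂ) ^ (-s)
      + (M : ℂ) ^ (1 - s) / (s - 1))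
      - (∑ n ∈ Finset.Icc 1 N, (n : ℂ) ^ (-s) + (N : ℂ) ^ (1 - s) / (s - 1))‖ ≤ 2 * ‖s‖ / N := by
    intro M hM
    have hid : (∑ n ∈ Finset.range (M + 1), (n : ℂ) ^ (-s) + (M : ℂ) ^ (1 - s) / (s - 1))
      - (∑ n ∈ Finset.Icc 1 N, (n : ℂ) ^ (-s) + (N : ℂ) ^ (1 - s) / (s - 1))
      = ∑ m ∈ Finset.Ico N M, (((m + 1 : ℕ) : ℂ) ^ (-s) -
      ((m : ℂ) ^ (1 - s) - ((m + 1 : ℕ) : ℂ) ^ (1 - s)) / (s - 1)) := by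
      induction M, hM using Nat.le_induction with
      | base =>
        simp only [Finset.Ico_self, Finset.sum_empty]
        rw [Finset.range_eq_Ico, Finset.sum_eq_sum_Ico_succ_bot (Nat.succ_pos _)]
        have : Finset.Ico (0 + 1) (N + 1) = Finset.Icc 1 N := by ext; simp [Nat.succ_le_iff]
        rw [this]
        simp [Complex.zero_cpow hs0]
      | succ M hM ih =>
        rw [Finset.sum_Ico_succ_top hM, ← ih, Finset.sum_range_succ _ (M + 1)]
        ring
    rw [hid]
    refine (norm_sum_le _ _).trans ?_
    calc _ ≤ ∑ m ∈ Finset.Ico N M, ‖s‖ * ((m : ℝ) ^ 2)⁻¹ := by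
          refine Finset.sum_le_sum fun m hm => ?_
          rw [← div_eq_mul_inv]
          exact norm_natCast_cpow_sub_telescope_le hs (hN.trans (Finset.mem_Ico.mp hm).1)
      _ ≤ ‖s‖ * (2 / N) := by
          rw [← Finset.mul_sum]
          gcongr
          exact sum_inv_sq_Ico_le hN M
      _ = _ := by ring
  have ht3 := ((ht1.add ht2).sub_const
    (∑ n ∈ Finset.Icc 1 N, (n : ℂ) ^ (-s) + (N : ℂ) ^ (1 - s) / (s - 1))).norm
  rw [add_zero] at ht3
  exact le_of_tendsto ht3 (Filter.eventually_atTop.mpr ⟨N, hfin⟩)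

theorem sum_inv_Icc_le_one_add_log {N : ℕ} :
    ∑ n ∈ Finset.Icc 1 N, ((n : ℝ))⁻¹ ≤ 1 + Real.log N := by
  have := harmonic_le_one_add_log N
  rw [harmonic_eq_sum_Icc] at this
  push_cast at this
  exact this

theorem norm_natCast_cpow_neg {n : ℕ} (hn : 1 ≤ n) (s : ℂ) :
    ‖(n : ℂ) ^ (-s)‖ = (n : ℝ) ^ (-s.re) := by
  rw [← Complex.ofReal_natCast, Complex.norm_cpow_eq_rpow_re_of_pos (by exact_mod_cast hn)]
  simp

theorem norm_cpow_one_sub_div_le {s : ℂ} (hs : 1 < s.re) {N : ℕ} (hN : 1 ≤ N)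
    (hu : 1 ≤ s.im) : ‖(N : ℂ) ^ (1 - s) / (s - 1)‖ ≤ 1 / s.im := by
  rw [norm_div]
  have h1 : ‖(N : ℂ) ^ (1 - s)‖ ≤ 1 := by
    rw [← neg_sub s 1, norm_natCast_cpow_neg hN]
    apply Real.rpow_le_one_of_one_le_of_nonpos (by exact_mod_cast hN)
    simp; linarith
  have h2 : s.im ≤ ‖s - 1‖ := by
    have := Complex.abs_im_le_norm (s - 1)
    simp at this
    exact (le_abs_self _).trans this
  gcongr

/-- `ζ(s)` is at most of size `log |Im s|` to the right of the line `Re s = 1`. -/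
theorem norm_riemannZeta_le_log {σ u : ℝ} (hσ : 0 < σ) (hσ2 : σ ≤ 2) (hu : 1 ≤ u) :
    ‖riemannZeta (1 + σ + u * Complex.I)‖ ≤ 12 + Real.log (2 * u) := by
  set s : ℂ := 1 + σ + u * Complex.I with hs
  have hre : s.re = 1 + σ := by simp [hs]
  have him : s.im = u := by simp [hs]
  have hs1 : 1 < s.re := by rw [hre]; linarith
  set N := ⌈u⌉₊
  have hN : 1 ≤ N := Nat.one_le_ceil_iff.mpr (by linarith)
  have hNu : u ≤ N := Nat.le_ceil u
  have hNu2 : (N : ℝ) ≤ 2 * u := by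
    have := Nat.ceil_lt_add_one (show 0 ≤ u by linarith)
    linarith
  have hN0 : (0 : ℝ) < N := by exact_mod_cast hN
  have h1 := norm_riemannZeta_sub_partial_sum_le hs1 hN
  have h2 := norm_cpow_one_sub_div_le hs1 hN (by rw [him]; exact hu)
  have h3 : ‖∑ n ∈ Finset.Icc 1 N, (n : ℂ) ^ (-s)‖ ≤ 1 + Real.log N := by
    refine (norm_sum_le _ _).trans (le_trans (Finset.sum_le_sum fun n hn => ?_)
      sum_inv_Icc_le_one_add_log)
    have hn1 := (Finset.mem_Icc.mp hn).1
    rw [norm_natCast_cpow_neg hn1, ← Real.rpow_neg_one]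
    exact Real.rpow_le_rpow_of_exponent_le (by exact_mod_cast hn1) (by linarith)
  have h4 : ‖s‖ ≤ 3 + u := by
    refine (Complex.norm_le_abs_re_add_abs_im s).trans ?_
    rw [hre, him, abs_of_pos (by linarith), abs_of_pos (by linarith)]
    linarith
  have h5 : 2 * ‖s‖ / N ≤ 8 := by
    rw [div_le_iff₀ hN0]
    nlinarith
  have h6 : 1 / s.im ≤ 1 := by
    rw [him, div_le_one (by linarith)]; exact hu
  have h7 : Real.log N ≤ Real.log (2 * u) := Real.log_le_log hN0 hNu2
  have h8 := norm_le_norm_sub_add (riemannZeta s)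
    (∑ n ∈ Finset.Icc 1 N, (n : ℂ) ^ (-s) + (N : ℂ) ^ (1 - s) / (s - 1))
  have h9 := norm_add_le (∑ n ∈ Finset.Icc 1 N, (n : ℂ) ^ (-s)) ((N : ℂ) ^ (1 - s) / (s - 1))
  linarith

theorem norm_riemannZeta_sub_le {σ σ₀ u : ℝ} (hσ : 0 < σ) (hσσ : σ ≤ σ₀) (hσ2 : σ₀ ≤ 2)
    (hu : 1 ≤ u) :
    ‖riemannZeta (1 + σ + u * Complex.I) - riemannZeta (1 + σ₀ + u * Complex.I)‖ ≤
      σ₀ * (1 + Real.log (2 * u ^ 2)) ^ 2 + 18 / u := by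
  set s : ℂ := 1 + σ + u * Complex.I with hs
  set s' : ℂ := 1 + σ₀ + u * Complex.I with hs'
  have hre : s.re = 1 + σ := by simp [hs]
  have him : s.im = u := by simp [hs]
  have hre' : s'.re = 1 + σ₀ := by simp [hs']
  have him' : s'.im = u := by simp [hs']
  have hs1 : 1 < s.re := by rw [hre]; linarith
  have hs1' : 1 < s'.re := by rw [hre']; linarith
  set N := ⌈u ^ 2⌉₊
  have hN : 1 ≤ N := Nat.one_le_ceil_iff.mpr (by positivity)
  have hNu : u ^ 2 ≤ N := Nat.le_ceil _
  have hNu2 : (N : ℝ) ≤ 2 * u ^ 2 := by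
    have := Nat.ceil_lt_add_one (show 0 ≤ u ^ 2 by positivity)
    nlinarith
  have hN0 : (0 : ℝ) < N := by exact_mod_cast hN
  have hN1 : (1 : ℝ) ≤ N := by exact_mod_cast hN
  have h1 := norm_riemannZeta_sub_partial_sum_le hs1 hN
  have h2 := norm_cpow_one_sub_div_le hs1 hN (by rw [him]; exact hu)
  have h1' := norm_riemannZeta_sub_partial_sum_le hs1' hN
  have h2' := norm_cpow_one_sub_div_le hs1' hN (by rw [him']; exact hu)
  have hlogN : Real.log N ≤ Real.log (2 * u ^ 2) := Real.log_le_log hN0 hNu2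
  have hlogN0 : 0 ≤ Real.log N := Real.log_nonneg hN1
  have h3 : ‖∑ n ∈ Finset.Icc 1 N, (n : ℂ) ^ (-s) - ∑ n ∈ Finset.Icc 1 N, (n : ℂ) ^ (-s')‖
      ≤ σ₀ * (1 + Real.log (2 * u ^ 2)) ^ 2 := by
    rw [← Finset.sum_sub_distrib]
    calc _ ≤ ∑ n ∈ Finset.Icc 1 N, ‖(n : ℂ) ^ (-s) - (n : ℂ) ^ (-s')‖ := norm_sum_le _ _
      _ ≤ ∑ n ∈ Finset.Icc 1 N, (σ₀ * Real.log N) * (n : ℝ)⁻¹ := by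
          refine Finset.sum_le_sum fun n hn => ?_
          have hn1 := (Finset.mem_Icc.mp hn).1
          have hn1' : (1 : ℝ) ≤ n := by exact_mod_cast hn1
          have hn2 : (n : ℝ) ≤ N := by exact_mod_cast (Finset.mem_Icc.mp hn).2
          have hne : (n : ℂ) ≠ 0 := by exact_mod_cast (by omega : n ≠ 0)
          have e1 : -s' = -s + ((-(σ₀ - σ) : ℝ) : ℂ) := by
            rw [hs, hs']; push_cast; ring
          rw [e1, Complex.cpow_add _ _ hne, ← mul_one_sub, norm_mul, norm_natCast_cpow_neg hn1,
            mul_comm]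
          have e2 : ‖1 - (n : ℂ) ^ ((-(σ₀ - σ) : ℝ) : ℂ)‖ = 1 - (n : ℝ) ^ (-(σ₀ - σ)) := by
            rw [← Complex.ofReal_natCast, ← Complex.ofReal_cpow (by positivity),
              ← Complex.ofReal_one, ← Complex.ofReal_sub, Complex.norm_real, Real.norm_eq_abs,
              abs_of_nonneg]
            rw [sub_nonneg]
            exact Real.rpow_le_one_of_one_le_of_nonpos hn1' (by linarith)
          rw [e2]
          gcongr
          · exact mul_nonneg (by linarith) hlogN0
          · rw [Real.rpow_def_of_pos (by linarith)]
            have := Real.add_one_le_exp (Real.log n * (-(σ₀ - σ)))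
            have hl : Real.log n ≤ Real.log N := Real.log_le_log (by linarith) hn2
            have hl0 : 0 ≤ Real.log n := Real.log_nonneg hn1'
            nlinarith
          · rw [← Real.rpow_neg_one]
            exact Real.rpow_le_rpow_of_exponent_le hn1' (by linarith)
      _ ≤ (σ₀ * Real.log N) * (1 + Real.log N) := by
          rw [← Finset.mul_sum]
          have : 0 ≤ σ₀ * Real.log N := mul_nonneg (by linarith) hlogN0
          exact mul_le_mul_of_nonneg_left sum_inv_Icc_le_one_add_log this
      _ ≤ _ := by
          rw [mul_assoc, sq]
          have : 0 ≤ σ₀ := by linarith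
          gcongr <;> linarith
  have hbd : ∀ z : ℂ, 0 ≤ z.re → z.re ≤ 3 → z.im = u → 2 * ‖z‖ / N ≤ 8 / u := by
    intro z hz0 hz hz'
    have h4 : ‖z‖ ≤ 3 + u := by
      refine (Complex.norm_le_abs_re_add_abs_im z).trans ?_
      rw [hz', abs_of_nonneg hz0, abs_of_pos (by linarith : 0 < u)]
      linarith
    rw [div_le_div_iff₀ hN0 (by linarith)]
    nlinarith
  have h5 := hbd s (by linarith) (by linarith) him
  have h5' := hbd s' (by linarith) (by linarith) him'
  rw [him] at h2
  rw [him'] at h2'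
  have hd1 : (18 : ℝ) / u = 8 / u + 8 / u + 1 / u + 1 / u := by ring
  set A := ∑ n ∈ Finset.Icc 1 N, (n : ℂ) ^ (-s)
  set A' := ∑ n ∈ Finset.Icc 1 N, (n : ℂ) ^ (-s')
  set B := (N : ℂ) ^ (1 - s) / (s - 1)
  set B' := (N : ℂ) ^ (1 - s') / (s' - 1)
  have : riemannZeta s - riemannZeta s' =
      (riemannZeta s - (A + B)) - (riemannZeta s' - (A' + B')) + (A - A') + (B - B') := by ring
  rw [this]
  refine (norm_add_le _ _).trans ?_
  have k1 := norm_add_le (riemannZeta s - (A + B) - (riemannZeta s' - (A' + B'))) (A - A')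
  have k2 := norm_sub_le (riemannZeta s - (A + B)) (riemannZeta s' - (A' + B'))
  have k3 := norm_sub_le B B'
  linarith

/-- Near the pole and on bounded heights, `ζ(s)` is comparable with `1 / (s - 1)`. -/
theorem riemannZeta_bounds_of_bounded_im (U : ℝ) (hU : 0 ≤ U) :
    ∃ c C : ℝ, 0 < c ∧ 0 < C ∧ ∀ σ u : ℝ, 0 < σ → σ ≤ 2 → 0 ≤ u → u ≤ U →
      c ≤ ‖riemannZeta (1 + σ + u * Complex.I)‖ * (σ + min u 1) ∧
      ‖riemannZeta (1 + σ + u * Complex.I)‖ * (σ + min u 1) ≤ C := by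
  set F : ℂ → ℂ := Function.update (fun s => (s - 1) * riemannZeta s) 1 1 with hF
  have hF1 : ∀ s, s ≠ 1 → F s = (s - 1) * riemannZeta s := fun s hs => by
    simp [hF, Function.update_of_ne hs]
  have hcont : Continuous F := by
    rw [continuous_iff_continuousAt]
    intro s
    by_cases hs : s = 1
    · subst hs
      rw [hF, continuousAt_update_same]
      exact riemannZeta_residue_one
    · have : ContinuousAt (fun s => (s - 1) * riemannZeta s) s :=
        (continuousAt_id.sub continuousAt_const).mul (differentiableAt_riemannZeta hs).continuousAt
      refine this.congr ?_
      filter_upwards [isOpen_ne.mem_nhds hs] with z hz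
      exact (hF1 z hz).symm
  have hK : IsCompact (Set.Icc (1 : ℝ) 3 ×ℂ Set.Icc 0 U) := isCompact_Icc.reProdIm isCompact_Icc
  have hne : ∀ s ∈ Set.Icc (1 : ℝ) 3 ×ℂ Set.Icc 0 U, 0 < ‖F s‖ := by
    intro s hs
    rw [norm_pos_iff]
    by_cases h1 : s = 1
    · simp [h1, hF]
    · rw [hF1 s h1]
      exact mul_ne_zero (sub_ne_zero.mpr h1) (riemannZeta_ne_zero_of_one_le_re hs.1.1)
  obtain ⟨m, hm, hmF⟩ := hK.exists_forall_le' (hcont.norm.continuousOn) hne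
  obtain ⟨M, hM⟩ := hK.exists_bound_of_continuousOn hcont.continuousOn
  refine ⟨m / (1 + U), 2 * (|M| + 1), by positivity, by positivity, ?_⟩
  intro σ u hσ hσ2 hu huU
  set s : ℂ := 1 + σ + u * Complex.I with hs
  have hre : s.re = 1 + σ := by simp [hs]
  have him : s.im = u := by simp [hs]
  have hsK : s ∈ Set.Icc (1 : ℝ) 3 ×ℂ Set.Icc 0 U := by
    refine ⟨⟨?_, ?_⟩, ⟨?_, ?_⟩⟩ <;> simp only [hre, him] <;> linarith
  have hs1 : s ≠ 1 := by
    intro h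
    rw [h] at hre
    simp at hre
    linarith
  have h1 := hmF s hsK
  have h2 := hM s hsK
  rw [hF1 s hs1, norm_mul] at h1 h2
  have hs1re : (s - 1).re = σ := by simp [hre]
  have hs1im : (s - 1).im = u := by simp [him]
  have a1 := Complex.norm_le_abs_re_add_abs_im (s - 1)
  have a2 := Complex.abs_re_le_norm (s - 1)
  have a3 := Complex.abs_im_le_norm (s - 1)
  rw [hs1re, abs_of_pos hσ] at a1 a2
  rw [hs1im, abs_of_nonneg hu] at a1 a3
  have hmin : 0 ≤ min u 1 := le_min hu zero_le_one
  have b1 : min u 1 ≤ u := min_le_left _ _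
  have b2 : u ≤ (1 + U) * min u 1 := by
    rcases le_total u 1 with h | h
    · rw [min_eq_left h]; nlinarith
    · rw [min_eq_right h]; linarith
  have hz := norm_nonneg (riemannZeta s)
  have c1 : ‖s - 1‖ ≤ (1 + U) * (σ + min u 1) := by nlinarith
  have c2 : σ + min u 1 ≤ 2 * ‖s - 1‖ := by linarith
  constructor
  · rw [div_le_iff₀ (by linarith)]
    nlinarith [mul_le_mul_of_nonneg_right c1 hz]
  · have := le_abs_self M
    nlinarith [mul_le_mul_of_nonneg_right c2 hz]

theorem norm_riemannZeta_le_rpow {ε σ u : ℝ} (hε : 0 < ε) (hσ : 0 < σ) (hσ2 : σ ≤ 2)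
    (hu : 1 ≤ u) :
    ‖riemannZeta (1 + σ + u * Complex.I)‖ ≤ (13 + 1 / ε) * u ^ ε := by
  refine (norm_riemannZeta_le_log hσ hσ2 hu).trans ?_
  have h1 : Real.log (2 * u) ≤ 1 + u ^ ε / ε := by
    rw [Real.log_mul (by norm_num) (by linarith)]
    have := Real.log_two_lt_d9
    have := Real.log_le_rpow_div (by linarith : 0 ≤ u) hε
    linarith
  have h2 : 1 ≤ u ^ ε := Real.one_le_rpow hu hε.le
  have h3 : (13 + 1 / ε) * u ^ ε = 13 * u ^ ε + u ^ ε / ε := by ring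
  linarith

theorem one_le_norm_riemannZeta_three_four_one {σ : ℝ} (hσ : 0 < σ) (u : ℝ) :
    1 ≤ ‖riemannZeta (1 + σ)‖ ^ 3 * ‖riemannZeta (1 + σ + u * Complex.I)‖ ^ 4 *
      ‖riemannZeta (1 + σ + (2 * u : ℝ) * Complex.I)‖ := by
  have h := DirichletCharacter.norm_LFunction_product_ge_one (1 : DirichletCharacter ℂ 1) hσ u
  rw [DirichletCharacter.LFunctionTrivChar, one_pow, DirichletCharacter.LFunction_modOne_eq,
    norm_mul, norm_mul, norm_pow, norm_pow] at h
  convert h using 4 <;> push_cast <;> ring_nf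

theorem exists_le_norm_riemannZeta_mul_rpow {ε : ℝ} (hε : 0 < ε) (hε1 : ε ≤ 1) :
    ∃ c u₀ : ℝ, 0 < c ∧ 1 ≤ u₀ ∧ ∀ σ u : ℝ, 0 < σ → σ ≤ 2 → u₀ ≤ u →
      c ≤ ‖riemannZeta (1 + σ + u * Complex.I)‖ * u ^ ε := by
  obtain ⟨_, C₁, _, hC₁, hζ⟩ := riemannZeta_bounds_of_bounded_im 0 le_rfl
  set C₂ : ℝ := (13 + 1 / (ε / 4)) * 2 ^ (ε / 4) with hC₂
  have hC₂0 : 0 < C₂ := by positivity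
  set K : ℝ := (C₁ ^ 3 * C₂)⁻¹ with hK
  have hK0 : 0 < K := by positivity
  set c : ℝ := min K 1 with hc
  have hc0 : 0 < c := lt_min hK0 one_pos
  have hcK : c ^ 4 ≤ K := by
    have h1 : c ≤ 1 := min_le_right _ _
    have h2 : c ≤ K := min_le_left _ _
    calc c ^ 4 ≤ c ^ 1 := pow_le_pow_of_le_one hc0.le h1 (by norm_num)
      _ ≤ K := by simpa using h2
  -- the range where `3-4-1` is applied directly
  have hbig : ∀ σ u : ℝ, 0 < σ → σ ≤ 2 → 1 ≤ u → u ^ (-ε) ≤ σ →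
      c * u ^ (-(13 / 16 * ε)) ≤ ‖riemannZeta (1 + σ + u * Complex.I)‖ := by
    intro σ u hσ hσ2 hu hσu
    have hu0 : 0 < u := by linarith
    have h1 := one_le_norm_riemannZeta_three_four_one hσ u
    have h2 : ‖riemannZeta (1 + σ)‖ * σ ≤ C₁ := by
      have := (hζ σ 0 hσ hσ2 le_rfl le_rfl).2
      simpa using this
    have h3 : ‖riemannZeta (1 + σ + (2 * u : ℝ) * Complex.I)‖ ≤ C₂ * u ^ (ε / 4) := by
      have := norm_riemannZeta_le_rpow (ε := ε / 4) (by linarith) hσ hσ2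
        (by linarith : 1 ≤ 2 * u)
      rwa [Real.mul_rpow (by norm_num) hu0.le, ← mul_assoc] at this
    set z := ‖riemannZeta (1 + σ + u * Complex.I)‖ with hz
    have hz0 : 0 ≤ z := norm_nonneg _
    have h4 : σ ^ 3 ≤ C₁ ^ 3 * z ^ 4 * (C₂ * u ^ (ε / 4)) := by
      calc σ ^ 3 ≤ σ ^ 3 * (‖riemannZeta (1 + σ)‖ ^ 3 * z ^ 4 *
            ‖riemannZeta (1 + σ + (2 * u : ℝ) * Complex.I)‖) :=
            le_mul_of_one_le_right (by positivity) h1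
        _ = (‖riemannZeta (1 + σ)‖ * σ) ^ 3 * z ^ 4 *
            ‖riemannZeta (1 + σ + (2 * u : ℝ) * Complex.I)‖ := by ring
        _ ≤ _ := by gcongr
    have h5 : u ^ (-(3 * ε)) ≤ σ ^ 3 := by
      calc u ^ (-(3 * ε)) = (u ^ (-ε)) ^ 3 := by
            rw [← Real.rpow_natCast, ← Real.rpow_mul hu0.le]; congr 1; push_cast; ring
        _ ≤ _ := by gcongr
    have h6 : (c * u ^ (-(13 / 16 * ε))) ^ 4 ≤ z ^ 4 := by
      rw [mul_pow]
      have e1 : (u ^ (-(13 / 16 * ε))) ^ 4 = u ^ (-(3 * ε)) * u ^ (-(ε / 4)) := by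
        rw [← Real.rpow_natCast, ← Real.rpow_mul hu0.le, ← Real.rpow_add hu0]
        congr 1; push_cast; ring
      have e2 : u ^ (-(ε / 4)) * u ^ (ε / 4) = 1 := by
        rw [← Real.rpow_add hu0]; simp
      rw [e1]
      calc c ^ 4 * (u ^ (-(3 * ε)) * u ^ (-(ε / 4)))
          ≤ K * ((C₁ ^ 3 * z ^ 4 * (C₂ * u ^ (ε / 4))) * u ^ (-(ε / 4))) := by
            gcongr; exact h5.trans h4
        _ = (C₁ ^ 3 * C₂)⁻¹ * (C₁ ^ 3 * C₂) * z ^ 4 * (u ^ (-(ε / 4)) * u ^ (ε / 4)) := by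
            rw [hK]; ring
        _ = z ^ 4 := by rw [e2, inv_mul_cancel₀ (by positivity)]; ring
    exact le_of_pow_le_pow_left₀ (by norm_num) hz0 h6
  -- comparison for smaller `σ`
  have hη : 0 < ε / 32 := by positivity
  set B : ℝ := 2 + 64 / ε with hB
  have hlog : ∀ u : ℝ, 1 ≤ u → 1 + Real.log (2 * u ^ 2) ≤ B * u ^ (ε / 32) := by
    intro u hu
    rw [Real.log_mul (by norm_num) (by positivity), Real.log_pow]
    have h1 := Real.log_two_lt_d9
    have h2 := Real.log_le_rpow_div (by linarith : 0 ≤ u) hη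
    have h3 : 1 ≤ u ^ (ε / 32) := Real.one_le_rpow hu hη.le
    have h4 : B * u ^ (ε / 32) = 2 * u ^ (ε / 32) + 2 * (u ^ (ε / 32) / (ε / 32)) := by
      rw [hB]; field_simp; ring
    push_cast
    linarith
  have hev : ∀ᶠ u : ℝ in Filter.atTop, (B ^ 2 + 18) * u ^ (-(ε / 8)) < c / 2 := by
    have := (tendsto_rpow_neg_atTop (show 0 < ε / 8 by positivity)).const_mul (B ^ 2 + 18)
    rw [mul_zero] at this
    exact this.eventually_lt_const (by positivity)
  obtain ⟨u₁, hu₁⟩ := Filter.eventually_atTop.mp hev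
  refine ⟨c / 2, max u₁ 1, by positivity, le_max_right _ _, ?_⟩
  intro σ u hσ hσ2 hu
  have hu1 : 1 ≤ u := (le_max_right _ _).trans hu
  have hu0 : 0 < u := by linarith
  have hsm := hu₁ u ((le_max_left _ _).trans hu)
  set z := ‖riemannZeta (1 + σ + u * Complex.I)‖ with hz
  have hmain : c / 2 * u ^ (-(13 / 16 * ε)) ≤ z := by
    by_cases hcase : u ^ (-ε) ≤ σ
    · refine le_trans ?_ (hbig σ u hσ hσ2 hu1 hcase)
      gcongr; linarith
    · push Not at hcase
      have hσ₀ : u ^ (-ε) ≤ 1 := Real.rpow_le_one_of_one_le_of_nonpos hu1 (by linarith)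
      have h1 := hbig (u ^ (-ε)) u (by positivity) (by linarith) hu1 le_rfl
      have h2 := norm_riemannZeta_sub_le hσ hcase.le (by linarith) hu1
      have h3 := norm_sub_norm_le (riemannZeta (1 + (u ^ (-ε) : ℝ) + u * Complex.I))
        (riemannZeta (1 + σ + u * Complex.I))
      rw [norm_sub_rev] at h3
      have h4 : u ^ (-ε) * (1 + Real.log (2 * u ^ 2)) ^ 2 ≤
          B ^ 2 * u ^ (-(ε / 8)) * u ^ (-(13 / 16 * ε)) := by
        have : 0 ≤ 1 + Real.log (2 * u ^ 2) := by
          have := Real.log_nonneg (show 1 ≤ 2 * u ^ 2 by nlinarith)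
          linarith
        calc u ^ (-ε) * (1 + Real.log (2 * u ^ 2)) ^ 2
            ≤ u ^ (-ε) * (B * u ^ (ε / 32)) ^ 2 := by gcongr; exact hlog u hu1
          _ = B ^ 2 * (u ^ (-ε) * u ^ (ε / 16)) := by
              rw [mul_pow, ← Real.rpow_natCast (u ^ (ε / 32)), ← Real.rpow_mul hu0.le]
              rw [show ε / 32 * ((2 : ℕ) : ℝ) = ε / 16 by push_cast; ring]
              ring
          _ = B ^ 2 * (u ^ (-(ε / 8)) * u ^ (-(13 / 16 * ε))) := by
              rw [← Real.rpow_add hu0, ← Real.rpow_add hu0]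
              congr 2; ring
          _ = _ := by ring
      have h5 : 18 / u ≤ 18 * u ^ (-(ε / 8)) * u ^ (-(13 / 16 * ε)) := by
        rw [mul_assoc, ← Real.rpow_add hu0, div_eq_mul_inv, ← Real.rpow_neg_one]
        gcongr
        linarith
      have h6 : (B ^ 2 + 18) * u ^ (-(ε / 8)) * u ^ (-(13 / 16 * ε)) ≤
          c / 2 * u ^ (-(13 / 16 * ε)) := by gcongr
      nlinarith
  have h7 : 1 ≤ u ^ (-(13 / 16 * ε)) * u ^ ε := by
    rw [← Real.rpow_add hu0]
    exact Real.one_le_rpow hu1 (by linarith)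
  calc c / 2 ≤ c / 2 * (u ^ (-(13 / 16 * ε)) * u ^ ε) := le_mul_of_one_le_right (by positivity) h7
    _ = c / 2 * u ^ (-(13 / 16 * ε)) * u ^ ε := by ring
    _ ≤ z * u ^ ε := by gcongr

/-- `log |ζ(1 + σ + iu)| = - log (σ + min(u, 1)) + O_ε(1) + O(ε log (1 + u))`. -/
theorem abs_log_norm_riemannZeta_add_log_le {ε : ℝ} (hε : 0 < ε) :
    ∃ C : ℝ, ∀ σ u : ℝ, 0 < σ → σ ≤ 2 → 0 ≤ u →
      |Real.log ‖riemannZeta (1 + σ + u * Complex.I)‖ + Real.log (σ + min u 1)| ≤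
        C + ε * Real.log (1 + u) := by
  set η : ℝ := min ε 1 with hη
  have hη0 : 0 < η := lt_min hε one_pos
  obtain ⟨c, u₀, hc, hu₀, hlow⟩ := exists_le_norm_riemannZeta_mul_rpow hη0 (min_le_right _ _)
  obtain ⟨c', C', hc', hC', hcomp⟩ := riemannZeta_bounds_of_bounded_im u₀ (by linarith)
  refine ⟨|Real.log c| + |Real.log c'| + |Real.log C'| + |Real.log (13 + 1 / η)| + 2, ?_⟩
  intro σ u hσ hσ2 hu
  have hs : riemannZeta (1 + σ + u * Complex.I) ≠ 0 :=
    riemannZeta_ne_zero_of_one_le_re (by simp; linarith)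
  have hz : 0 < ‖riemannZeta (1 + σ + u * Complex.I)‖ := norm_pos_iff.mpr hs
  have hmin : 0 ≤ min u 1 := le_min hu zero_le_one
  have hlogu : 0 ≤ Real.log (1 + u) := Real.log_nonneg (by linarith)
  have t1 := neg_abs_le (Real.log c)
  have t2 := neg_abs_le (Real.log c')
  have t3 := le_abs_self (Real.log C')
  have t4 := le_abs_self (Real.log (13 + 1 / η))
  have t5 := abs_nonneg (Real.log c)
  have t6 := abs_nonneg (Real.log c')
  have t7 := abs_nonneg (Real.log C')
  have t8 := abs_nonneg (Real.log (13 + 1 / η))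
  have hε' := mul_nonneg hε.le hlogu
  rcases le_total u u₀ with h | h
  · obtain ⟨h1, h2⟩ := hcomp σ u hσ hσ2 hu h
    rw [← Real.log_mul hz.ne' (by positivity)]
    have h3 := Real.log_le_log hc' h1
    have h4 := Real.log_le_log (by positivity) h2
    rw [abs_le]
    constructor <;> linarith
  · have hu1 : 1 ≤ u := hu₀.trans h
    have hu0 : 0 < u := by linarith
    have h1 := hlow σ u hσ hσ2 h
    have h2 := norm_riemannZeta_le_rpow hη0 hσ hσ2 hu1
    have h3 := Real.log_le_log hc h1
    have h4 := Real.log_le_log hz h2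
    rw [Real.log_mul hz.ne' (by positivity), Real.log_rpow hu0] at h3
    rw [Real.log_mul (by positivity) (by positivity), Real.log_rpow hu0] at h4
    have h5 : η * Real.log u ≤ ε * Real.log (1 + u) := by
      have : Real.log u ≤ Real.log (1 + u) := Real.log_le_log hu0 (by linarith)
      have h0 : 0 ≤ Real.log u := Real.log_nonneg hu1
      have : η ≤ ε := min_le_left _ _
      gcongr
    rw [min_eq_right hu1]
    have h6 : 0 ≤ Real.log (σ + 1) := Real.log_nonneg (by linarith)
    have h7 : Real.log (σ + 1) ≤ 2 := by
      have := Real.log_le_sub_one_of_pos (show 0 < σ + 1 by linarith)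
      linarith
    rw [abs_le]
    constructor <;> linarith

/-- The primes not exceeding `R`. -/
noncomputable def primesUpTo (R : ℝ) : Finset ℕ := (Finset.Icc 1 ⌊R⌋₊).filter Nat.Prime

theorem mem_primesUpTo {R : ℝ} {p : ℕ} : p ∈ primesUpTo R ↔ p.Prime ∧ (p : ℝ) ≤ R := by
  rw [primesUpTo, Finset.mem_filter, Finset.mem_Icc]
  constructor
  · rintro ⟨⟨h1, h2⟩, h3⟩
    exact ⟨h3, (Nat.le_floor_iff' (by omega)).mp h2⟩
  · rintro ⟨h1, h2⟩
    exact ⟨⟨h1.one_le, (Nat.le_floor_iff' h1.ne_zero).mpr h2⟩, h1⟩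

theorem re_natCast_cpow_neg {n : ℕ} (hn : 1 ≤ n) (σ u : ℝ) :
    ((n : ℂ) ^ (-(1 + σ + u * Complex.I) : ℂ)).re =
      (n : ℝ) ^ (-(1 + σ)) * Real.cos (u * Real.log n) := by
  have hn0 : (0 : ℝ) < n := by exact_mod_cast hn
  have hne : (n : ℂ) ≠ 0 := by exact_mod_cast (by omega : n ≠ 0)
  rw [Complex.cpow_def_of_ne_zero hne, Complex.natCast_log.symm, Complex.exp_re,
    Real.rpow_def_of_pos hn0]
  have h1 : ((Real.log n : ℂ) * (-(1 + σ + u * Complex.I))).re = Real.log n * (-(1 + σ)) := by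
    rw [Complex.re_ofReal_mul]; simp
  have h2 : ((Real.log n : ℂ) * (-(1 + σ + u * Complex.I))).im = -(u * Real.log n) := by
    rw [Complex.im_ofReal_mul]; simp; ring
  rw [h1, h2, Real.cos_neg]

theorem summable_primes_rpow_mul_cos {σ : ℝ} (hσ : 0 < σ) (u : ℝ) :
    Summable fun p : Nat.Primes => (p : ℝ) ^ (-(1 + σ)) * Real.cos (u * Real.log p) := by
  refine Summable.of_norm_bounded (g := fun p : Nat.Primes => (p : ℝ) ^ (-(1 + σ)))
    (Nat.Primes.summable_rpow.mpr (by linarith)) fun p => ?_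
  rw [norm_mul, Real.norm_of_nonneg (by positivity)]
  exact mul_le_of_le_one_right (by positivity) (Real.abs_cos_le_one _)

theorem exists_abs_tsum_primes_sub_log_norm_riemannZeta_le :
    ∃ C : ℝ, ∀ σ u : ℝ, 0 < σ →
      |∑' p : Nat.Primes, (p : ℝ) ^ (-(1 + σ)) * Real.cos (u * Real.log p) -
        Real.log ‖riemannZeta (1 + σ + u * Complex.I)‖| ≤ C := by
  have hC : Summable fun p : Nat.Primes => (p : ℝ) ^ (-2 : ℝ) :=
    Nat.Primes.summable_rpow.mpr (by norm_num)
  refine ⟨∑' p : Nat.Primes, (p : ℝ) ^ (-2 : ℝ), fun σ u hσ => ?_⟩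
  set s : ℂ := 1 + σ + u * Complex.I with hs
  have hre : s.re = 1 + σ := by simp [hs]
  have hs1 : 1 < s.re := by linarith
  have hsum : Summable fun p : Nat.Primes => -Complex.log (1 - (p : ℂ) ^ (-s)) := by
    have := DirichletCharacter.summable_neg_log_one_sub_mul_prime_cpow
      (1 : DirichletCharacter ℂ 1) hs1
    refine this.congr fun p => ?_
    rw [MulChar.one_apply (isUnit_of_subsingleton _), one_mul]
  have hnorm : ∀ p : Nat.Primes, ‖((p : ℕ) : ℂ) ^ (-s)‖ = (p : ℝ) ^ (-(1 + σ)) := fun p => by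
    rw [norm_natCast_cpow_neg p.2.one_le, hre]
  have hlog : Real.log ‖riemannZeta s‖ =
      ∑' p : Nat.Primes, (-Complex.log (1 - (p : ℂ) ^ (-s))).re := by
    rw [← riemannZeta_eulerProduct_exp_log hs1, Complex.norm_exp, Real.log_exp, Complex.re_tsum hsum]
  have hterm : ∀ p : Nat.Primes, ‖(p : ℝ) ^ (-(1 + σ)) * Real.cos (u * Real.log p) -
      (-Complex.log (1 - (p : ℂ) ^ (-s))).re‖ ≤ (p : ℝ) ^ (-2 : ℝ) := by
    intro p
    have hp2 : (2 : ℝ) ≤ (p : ℕ) := by exact_mod_cast p.2.two_le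
    have hp1 : (1 : ℝ) ≤ (p : ℕ) := by linarith
    set z : ℂ := (p : ℂ) ^ (-s) with hz
    have hz1 : ‖z‖ ≤ (p : ℝ) ^ (-1 : ℝ) := by
      rw [hnorm]
      exact Real.rpow_le_rpow_of_exponent_le hp1 (by linarith)
    have hz2 : ‖z‖ ≤ 1 / 2 := by
      refine hz1.trans ?_
      rw [Real.rpow_neg_one, one_div]
      exact inv_anti₀ (by norm_num) hp2
    have h1 := Complex.norm_log_one_add_sub_self_le (z := -z) (by rw [norm_neg]; linarith)
    rw [norm_neg] at h1
    have h2 : (1 - ‖z‖)⁻¹ ≤ 2 := by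
      rw [inv_le_comm₀ (by linarith) (by norm_num)]; linarith
    have h3 : ‖Complex.log (1 + -z) - -z‖ ≤ ‖z‖ ^ 2 := by
      refine h1.trans ?_
      nlinarith [sq_nonneg ‖z‖]
    rw [← re_natCast_cpow_neg p.2.one_le, ← Complex.sub_re]
    refine (Complex.abs_re_le_norm _).trans ?_
    have h4 : z - -Complex.log (1 - z) = Complex.log (1 + -z) - -z := by
      rw [← sub_eq_add_neg]; ring
    refine (le_of_eq (congrArg norm h4)).trans (h3.trans ?_)
    calc ‖z‖ ^ 2 ≤ ((p : ℝ) ^ (-1 : ℝ)) ^ 2 := by gcongr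
      _ = _ := by
        rw [← Real.rpow_natCast, ← Real.rpow_mul (by linarith)]; norm_num
  rw [hlog, ← (summable_primes_rpow_mul_cos hσ u).tsum_sub (Complex.hasSum_re hsum.hasSum).summable]
  exact tsum_of_norm_bounded hC.hasSum hterm

theorem abs_tsum_primes_add_log_le {ε : ℝ} (hε : 0 < ε) :
    ∃ C : ℝ, ∀ σ u : ℝ, 0 < σ → σ ≤ 2 →
      |∑' p : Nat.Primes, (p : ℝ) ^ (-(1 + σ)) * Real.cos (u * Real.log p) +
        Real.log (σ + min |u| 1)| ≤ C + ε * Real.log (1 + |u|) := by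
  obtain ⟨C₁, h₁⟩ := exists_abs_tsum_primes_sub_log_norm_riemannZeta_le
  obtain ⟨C₂, h₂⟩ := abs_log_norm_riemannZeta_add_log_le hε
  refine ⟨C₁ + C₂, fun σ u hσ hσ2 => ?_⟩
  have he : ∀ p : Nat.Primes, (p : ℝ) ^ (-(1 + σ)) * Real.cos (u * Real.log p) =
      (p : ℝ) ^ (-(1 + σ)) * Real.cos (|u| * Real.log p) := by
    intro p
    rcases abs_choice u with h | h <;> rw [h]
    rw [neg_mul, Real.cos_neg]
  rw [tsum_congr he]
  have a := abs_le.mp (h₁ σ |u| hσ)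
  have b := abs_le.mp (h₂ σ |u| hσ hσ2 (abs_nonneg u))
  rw [abs_le]
  constructor <;> linarith [a.1, a.2, b.1, b.2]

/-- `∑_{p ≤ R} cos(u log p) / p = - log (1 / log R + min(|u|, 1)) + O_ε(1) + O(ε log(1 + |u|))`. -/
theorem abs_sum_primes_cos_div_add_log_le {ε : ℝ} (hε : 0 < ε) :
    ∃ C : ℝ, ∀ R u : ℝ, 2 ≤ R →
      |∑ p ∈ primesUpTo R, Real.cos (u * Real.log p) / p +
        Real.log (1 / Real.log R + min |u| 1)| ≤ C + ε * Real.log (1 + |u|) := by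
  obtain ⟨C, hC⟩ := abs_tsum_primes_add_log_le hε
  refine ⟨C + 4 * (2 * C + Real.log 2), fun R u hR => ?_⟩
  set L := Real.log R with hL
  have hlog2 := Real.log_two_gt_d9
  have hL2 : Real.log 2 ≤ L := Real.log_le_log (by norm_num) hR
  have hL0 : 0 < L := by linarith
  set σ : ℝ := 1 / L with hσ
  have hσ0 : 0 < σ := by positivity
  have hσ2 : σ ≤ 2 := by
    rw [hσ, div_le_iff₀ hL0]; linarith
  have hfin : ∑ p ∈ primesUpTo R, Real.cos (u * Real.log p) / p =
      ∑' p : Nat.Primes, if (p : ℝ) ≤ R then Real.cos (u * Real.log p) / p else 0 := by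
    have := tsum_subtype {p : ℕ | p.Prime}
      (fun p : ℕ => if (p : ℝ) ≤ R then Real.cos (u * Real.log p) / p else 0)
    refine Eq.trans ?_ this.symm
    rw [tsum_eq_sum (s := primesUpTo R)]
    · refine Finset.sum_congr rfl fun p hp => ?_
      obtain ⟨h1, h2⟩ := mem_primesUpTo.mp hp
      rw [Set.indicator_of_mem (by exact h1), if_pos h2]
    · intro p hp
      by_cases h1 : p.Prime
      · rw [Set.indicator_of_mem (by exact h1), if_neg]
        exact fun h2 => hp (mem_primesUpTo.mpr ⟨h1, h2⟩)
      · rw [Set.indicator_of_notMem (by exact h1)]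
  have hsumfin : Summable fun p : Nat.Primes =>
      if (p : ℝ) ≤ R then Real.cos (u * Real.log p) / p else 0 := by
    have h0 : Summable (fun p : ℕ => if (p : ℝ) ≤ R then Real.cos (u * Real.log p) / p else 0) := by
      refine summable_of_ne_finset_zero (s := Finset.range (⌊R⌋₊ + 1)) fun p hp => if_neg ?_
      intro h
      exact hp (Finset.mem_range.mpr (Nat.lt_succ_of_le (Nat.le_floor h)))
    exact h0.subtype _
  have hs1 := summable_primes_rpow_mul_cos hσ0 u
  have hs2 : Summable fun p : Nat.Primes => (p : ℝ) ^ (-(1 + σ)) :=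
    Nat.Primes.summable_rpow.mpr (by linarith)
  have hs3 : Summable fun p : Nat.Primes => (p : ℝ) ^ (-(1 + σ / 2)) :=
    Nat.Primes.summable_rpow.mpr (by linarith)
  have hterm : ∀ p : Nat.Primes, ‖(if (p : ℝ) ≤ R then Real.cos (u * Real.log p) / p else 0) -
      (p : ℝ) ^ (-(1 + σ)) * Real.cos (u * Real.log p)‖ ≤
      4 * ((p : ℝ) ^ (-(1 + σ / 2)) - (p : ℝ) ^ (-(1 + σ))) := by
    intro p
    have hp2 : (2 : ℝ) ≤ (p : ℕ) := by exact_mod_cast p.2.two_le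
    have hp0 : (0 : ℝ) < (p : ℕ) := by linarith
    set y : ℝ := (p : ℝ) ^ (-(σ / 2)) with hy
    have hy0 : 0 < y := by positivity
    have hye : y = Real.exp (-(Real.log p / (2 * L))) := by
      rw [hy, Real.rpow_def_of_pos hp0, hσ]
      congr 1
      field_simp
    have e1 : (p : ℝ) ^ (-(1 + σ / 2)) = y / p := by
      rw [neg_add, Real.rpow_add hp0, Real.rpow_neg_one]; ring
    have e2 : (p : ℝ) ^ (-(1 + σ)) = y ^ 2 / p := by
      rw [neg_add, Real.rpow_add hp0, Real.rpow_neg_one, hy, ← Real.rpow_natCast,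
        ← Real.rpow_mul hp0.le, div_eq_inv_mul]
      congr 2; push_cast; ring
    rw [e1, e2]
    have hy1 : y ≤ 1 := by
      rw [hye, Real.exp_le_one_iff, neg_nonpos]
      have := Real.log_nonneg (show (1 : ℝ) ≤ (p : ℕ) by linarith)
      positivity
    have hc := Real.abs_cos_le_one (u * Real.log p)
    split_ifs with hpR
    · have hlogp : Real.log p ≤ L := Real.log_le_log hp0 hpR
      have hyl : 1 / 2 ≤ y := by
        have h1 := Real.add_one_le_exp (-(Real.log p / (2 * L)))
        have h2 : Real.log p / (2 * L) ≤ 1 / 2 := by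
          rw [div_le_div_iff₀ (by linarith) (by norm_num)]; linarith
        rw [hye]; linarith
      have e3 : Real.cos (u * Real.log p) / p - y ^ 2 / p * Real.cos (u * Real.log p) =
          Real.cos (u * Real.log p) * ((1 - y ^ 2) / p) := by ring
      have h3 : 0 ≤ 1 - y ^ 2 := by nlinarith
      rw [e3, norm_mul, Real.norm_of_nonneg (div_nonneg h3 hp0.le)]
      refine (mul_le_of_le_one_left (div_nonneg h3 hp0.le) hc).trans ?_
      rw [← sub_div, ← mul_div_assoc]
      gcongr
      nlinarith
    · push Not at hpR
      have hlogp : L ≤ Real.log p := Real.log_le_log (by linarith) hpR.le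
      have hyl : y ≤ 2 / 3 := by
        have h1 := Real.add_one_le_exp (1 / 2 : ℝ)
        have h2 : 1 / 2 ≤ Real.log p / (2 * L) := by
          rw [div_le_div_iff₀ (by norm_num) (by linarith)]; linarith
        rw [hye, Real.exp_neg, inv_le_comm₀ (Real.exp_pos _) (by norm_num)]
        have h3 := Real.exp_le_exp.mpr h2
        norm_num at h1 ⊢
        linarith
      rw [zero_sub, norm_neg, norm_mul, Real.norm_of_nonneg (by positivity)]
      refine (mul_le_of_le_one_right (by positivity) hc).trans ?_
      rw [← sub_div, ← mul_div_assoc]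
      gcongr
      nlinarith
  have hdiff : |∑ p ∈ primesUpTo R, Real.cos (u * Real.log p) / p -
      ∑' p : Nat.Primes, (p : ℝ) ^ (-(1 + σ)) * Real.cos (u * Real.log p)| ≤
      4 * (∑' p : Nat.Primes, (p : ℝ) ^ (-(1 + σ / 2)) -
        ∑' p : Nat.Primes, (p : ℝ) ^ (-(1 + σ))) := by
    rw [hfin, ← hsumfin.tsum_sub hs1, ← hs3.tsum_sub hs2, ← tsum_mul_left]
    exact tsum_of_norm_bounded ((hs3.sub hs2).mul_left 4).hasSum hterm
  have h1 := hC σ u hσ0 hσ2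
  have h2 := hC σ 0 hσ0 hσ2
  have h3 := hC (σ / 2) 0 (by positivity) (by linarith)
  simp only [zero_mul, Real.cos_zero, mul_one, abs_zero, add_zero, Real.log_one, mul_zero,
    min_eq_left (zero_le_one' ℝ)] at h2 h3
  have h4 : Real.log (σ / 2) = Real.log σ - Real.log 2 := Real.log_div hσ0.ne' (by norm_num)
  rw [h4] at h3
  rw [abs_le] at *
  constructor <;> linarith [h1.1, h1.2, h2.1, h2.2, h3.1, h3.2, hdiff.1, hdiff.2]

theorem prod_primeFactors_mul_le_of_isPrimePow {g : ℕ → ℝ} {K : ℝ} (hK : 1 ≤ K)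
    (hg0 : ∀ p, 0 ≤ g p) (hgK : ∀ p, g p ≤ K) {d m : ℕ} (hd : IsPrimePow d) (hm : m ≠ 0) :
    ∏ p ∈ (d * m).primeFactors, g p ≤ K * ∏ p ∈ m.primeFactors, g p := by
  obtain ⟨p, k, hp, hk, rfl⟩ := hd
  have hp' := hp.nat_prime
  have hP : 0 ≤ ∏ p ∈ m.primeFactors, g p := Finset.prod_nonneg fun _ _ => hg0 _
  rw [Nat.primeFactors_mul (pow_ne_zero _ hp'.ne_zero) hm, Nat.primeFactors_prime_pow hk.ne' hp',
    ← Finset.insert_eq]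
  by_cases h : p ∈ m.primeFactors
  · rw [Finset.insert_eq_of_mem h]
    exact le_mul_of_one_le_left hP hK
  · rw [Finset.prod_insert h]
    exact mul_le_mul_of_nonneg_right (hgK p) hP

/-- A multiplicative function depending only on the set of prime factors and bounded on primes
satisfies `log x ∑_{n ≤ x} H(n) ≪ x ∑_{n ≤ x} H(n) / n`. -/
theorem log_mul_sum_prod_primeFactors_le {g : ℕ → ℝ} {K : ℝ} (hK : 1 ≤ K)
    (hg0 : ∀ p, 0 ≤ g p) (hgK : ∀ p, g p ≤ K) {x : ℝ} (hx : 1 ≤ x) :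
    Real.log x * ∑ n ∈ Finset.Icc 1 ⌊x⌋₊, ∏ p ∈ n.primeFactors, g p ≤
      (1 + K * (Real.log 4 + 4)) * x *
        ∑ n ∈ Finset.Icc 1 ⌊x⌋₊, (∏ p ∈ n.primeFactors, g p) / n := by
  set N := ⌊x⌋₊ with hN
  have hIcc : Finset.Icc 1 N = Finset.Ioc 0 N := by ext; simp [Nat.succ_le_iff]
  rw [hIcc]
  set H : ℕ → ℝ := fun n => ∏ p ∈ n.primeFactors, g p with hH
  have hH0 : ∀ n, 0 ≤ H n := fun n => Finset.prod_nonneg fun _ _ => hg0 _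
  set F : ArithmeticFunction ℝ := ⟨fun n => if n = 0 then 0 else H n, if_pos rfl⟩ with hF
  have hFn : ∀ n, n ≠ 0 → F n = H n := fun n hn => if_neg hn
  have hx0 : 0 < x := by linarith
  have hpoint : ∀ n ∈ Finset.Ioc 0 N, Real.log x * H n ≤
      x * (H n / n) + K * (F * ArithmeticFunction.vonMangoldt) n := by
    intro n hn
    have hn0 : n ≠ 0 := by have := (Finset.mem_Ioc.mp hn).1; omega
    have hn1 : (0 : ℝ) < n := by exact_mod_cast Nat.pos_of_ne_zero hn0
    have h1 : Real.log x = Real.log (x / n) + Real.log n := by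
      rw [Real.log_div hx0.ne' hn1.ne']; ring
    have h2 : Real.log (x / n) ≤ x / n :=
      (Real.log_le_sub_one_of_pos (by positivity)).trans (by linarith)
    have h3 : Real.log n * H n ≤ K * (F * ArithmeticFunction.vonMangoldt) n := by
      rw [← ArithmeticFunction.vonMangoldt_sum, ArithmeticFunction.mul_apply, Finset.mul_sum,
        Finset.sum_mul, Nat.sum_divisorsAntidiagonal'
          (fun a b => K * (F a * ArithmeticFunction.vonMangoldt b))]
      refine Finset.sum_le_sum fun d hd => ?_
      have hdn := Nat.dvd_of_mem_divisors hd
      obtain ⟨m, rfl⟩ := hdn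
      have hd0 : d ≠ 0 := left_ne_zero_of_mul hn0
      have hm0 : m ≠ 0 := right_ne_zero_of_mul hn0
      rw [Nat.mul_div_cancel_left m (Nat.pos_of_ne_zero hd0), hFn m hm0]
      by_cases hΛ : ArithmeticFunction.vonMangoldt d = 0
      · simp [hΛ]
      · have := prod_primeFactors_mul_le_of_isPrimePow hK hg0 hgK
          (ArithmeticFunction.vonMangoldt_ne_zero_iff.mp hΛ) hm0
        have h0 : 0 ≤ ArithmeticFunction.vonMangoldt d := ArithmeticFunction.vonMangoldt_nonneg
        calc ArithmeticFunction.vonMangoldt d * H (d * m)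
            ≤ ArithmeticFunction.vonMangoldt d * (K * H m) := by gcongr
          _ = _ := by ring
    have h4 : Real.log (x / n) * H n ≤ x * (H n / n) := by
      calc _ ≤ x / n * H n := mul_le_mul_of_nonneg_right h2 (hH0 n)
        _ = _ := by ring
    rw [h1, add_mul]
    linarith
  rw [Finset.mul_sum]
  refine (Finset.sum_le_sum hpoint).trans ?_
  rw [Finset.sum_add_distrib, ← Finset.mul_sum, ← Finset.mul_sum,
    ArithmeticFunction.sum_Ioc_mul_eq_sum_sum]
  have h5 : ∑ n ∈ Finset.Ioc 0 N, F n * ∑ m ∈ Finset.Ioc 0 (N / n), ArithmeticFunction.vonMangoldt m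
      ≤ (Real.log 4 + 4) * x * ∑ n ∈ Finset.Ioc 0 N, H n / n := by
    rw [Finset.mul_sum]
    refine Finset.sum_le_sum fun n hn => ?_
    have hn0 : n ≠ 0 := by have := (Finset.mem_Ioc.mp hn).1; omega
    have hn1 : (0 : ℝ) < n := by exact_mod_cast Nat.pos_of_ne_zero hn0
    have h6 : ∑ m ∈ Finset.Ioc 0 (N / n), ArithmeticFunction.vonMangoldt m =
        Chebyshev.psi (x / n) := by
      rw [Chebyshev.psi, Nat.floor_div_natCast]
    rw [h6, hFn n hn0]
    calc H n * Chebyshev.psi (x / n) ≤ H n * ((Real.log 4 + 4) * (x / n)) :=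
          mul_le_mul_of_nonneg_left (Chebyshev.psi_le_const_mul_self (by positivity)) (hH0 n)
      _ = _ := by ring
  have h7 := mul_le_mul_of_nonneg_left h5 (by linarith : 0 ≤ K)
  linarith

theorem sum_prod_primeFactors_div_le_prod {g : ℕ → ℝ} (hg0 : ∀ p, 0 ≤ g p) (N : ℕ) :
    ∑ n ∈ Finset.Icc 1 N, (∏ p ∈ n.primeFactors, g p) / n ≤
      ∏ p ∈ (N + 1).primesBelow, (1 + g p / (p - 1)) := by
  set F : ℕ → ℝ := fun n => (∏ p ∈ n.primeFactors, g p) / n with hF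
  have hF0 : ∀ n, 0 ≤ F n := fun n =>
    div_nonneg (Finset.prod_nonneg fun _ _ => hg0 _) (Nat.cast_nonneg _)
  have hF1 : F 1 = 1 := by simp [hF]
  have hmul : ∀ {m n : ℕ}, Nat.Coprime m n → F (m * n) = F m * F n := by
    intro m n hmn
    simp only [hF]
    rw [hmn.primeFactors_mul, Finset.prod_union hmn.disjoint_primeFactors, Nat.cast_mul]
    ring
  have hpow : ∀ {p : ℕ}, p.Prime → HasSum (fun n : ℕ => F (p ^ n)) (1 + g p / (p - 1)) := by
    intro p hp
    have hp1 : (1 : ℝ) < p := by exact_mod_cast hp.one_lt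
    have h1 : ∀ n : ℕ, F (p ^ (n + 1)) = g p / p * ((p : ℝ)⁻¹) ^ n := by
      intro n
      simp only [hF]
      rw [Nat.primeFactors_prime_pow (by omega) hp, Finset.prod_singleton]
      push_cast
      rw [pow_succ, inv_pow]
      field_simp
    have h2 := (hasSum_geometric_of_lt_one (r := (p : ℝ)⁻¹) (by positivity)
      (inv_lt_one_of_one_lt₀ hp1)).mul_left (g p / p)
    simp only [← h1] at h2
    refine (hasSum_nat_add_iff' 1).mp ?_
    have h3 : (p : ℝ) - 1 ≠ 0 := by linarith
    have h4 : 1 + g p / ((p : ℝ) - 1) - ∑ i ∈ Finset.range 1, F (p ^ i) =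
        g p / p * (1 - (p : ℝ)⁻¹)⁻¹ := by
      rw [Finset.sum_range_one, pow_zero, hF1]
      field_simp
      ring
    rw [h4]
    exact h2
  have hsum : ∀ {p : ℕ}, p.Prime → Summable (fun n : ℕ => ‖F (p ^ n)‖) := by
    intro p hp
    simp only [Real.norm_of_nonneg (hF0 _)]
    exact (hpow hp).summable
  obtain ⟨hs, hprod⟩ := EulerProduct.summable_and_hasSum_smoothNumbers_prod_primesBelow_tsum
    hF1 hmul hsum (N + 1)
  have he : ∏ p ∈ (N + 1).primesBelow, (1 + g p / ((p : ℝ) - 1)) =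
      ∏ p ∈ (N + 1).primesBelow, ∑' n : ℕ, F (p ^ n) :=
    Finset.prod_congr rfl fun p hp => ((hpow (Nat.prime_of_mem_primesBelow hp)).tsum_eq).symm
  rw [he]
  have hinj : Set.InjOn (fun n : ℕ => n) (Finset.Icc 1 N : Set ℕ) := fun _ _ _ _ h => h
  have hmem : ∀ n ∈ Finset.Icc 1 N, n ∈ (N + 1).smoothNumbers := fun n hn =>
    Nat.mem_smoothNumbers_of_lt (Finset.mem_Icc.mp hn).1
      (Nat.lt_succ_of_le (Finset.mem_Icc.mp hn).2)
  have h3 : ∑ n ∈ Finset.Icc 1 N, F n =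
      ∑ n ∈ (Finset.Icc 1 N).subtype (· ∈ (N + 1).smoothNumbers), F n :=
    (Finset.sum_subtype_of_mem F hmem).symm
  rw [h3]
  exact sum_le_hasSum _ (fun n _ => hF0 _) hprod

theorem sum_inv_mul_pred_primesBelow_le (N : ℕ) :
    ∑ p ∈ N.primesBelow, (1 : ℝ) / (p * (p - 1)) ≤ 1 := by
  have h : ∀ M : ℕ, ∑ n ∈ Finset.range M, (1 : ℝ) / ((n + 2) * (n + 1)) ≤ 1 - 1 / (M + 1) := by
    intro M
    induction M with
    | zero => simp
    | succ M ih =>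
      rw [Finset.sum_range_succ]
      refine (add_le_add_left ih _).trans (le_of_eq ?_)
      push_cast
      field_simp
      ring
  have h2 : ∑ p ∈ N.primesBelow, (1 : ℝ) / (p * (p - 1)) ≤
      ∑ n ∈ Finset.Ico 2 (N + 2), (1 : ℝ) / (n * (n - 1)) := by
    refine Finset.sum_le_sum_of_subset_of_nonneg (fun p hp => ?_) fun n hn _ => ?_
    · rw [Finset.mem_Ico]
      have h1 := (Nat.prime_of_mem_primesBelow hp).two_le
      have h2 := Nat.lt_of_mem_primesBelow hp
      omega
    · have : (2 : ℝ) ≤ n := by exact_mod_cast (Finset.mem_Ico.mp hn).1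
      have : (0 : ℝ) ≤ n - 1 := by linarith
      positivity
  refine h2.trans ?_
  rw [Finset.sum_Ico_eq_sum_range, Nat.add_sub_cancel]
  have h3 := h N
  have h4 : (0 : ℝ) ≤ 1 / ((N : ℝ) + 1) := by positivity
  refine le_trans (le_of_eq (Finset.sum_congr rfl fun n _ => ?_)) (h3.trans (by linarith))
  push_cast
  congr 1
  ring

/-- Upper bound for sums of multiplicative functions supported on the small prime factors. -/
theorem exists_sum_prod_primeFactors_filter_le (K₀ : ℝ) :
    ∃ K : ℝ, 0 < K ∧ ∀ (x R : ℝ) (h : ℕ → ℝ), 2 ≤ R → R ≤ x → (∀ p, 0 ≤ h p) →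
      (∀ p, h p ≤ K₀) →
      ∑ n ∈ Finset.Icc 1 ⌊x⌋₊, ∏ p ∈ n.primeFactors with ((p : ℕ) : ℝ) ≤ R, h p ≤
        K * (x / Real.log R) * Real.exp (∑ p ∈ primesUpTo R, h p / p) := by
  obtain ⟨C, hC⟩ := abs_sum_primes_cos_div_add_log_le one_pos
  set K₁ : ℝ := max K₀ 1 with hK₁
  have hK₁1 : 1 ≤ K₁ := le_max_right _ _
  have hl4 : 0 ≤ Real.log 4 := Real.log_nonneg (by norm_num)
  refine ⟨(1 + K₁ * (Real.log 4 + 4)) * Real.exp (K₁ + 2 * C), by positivity, ?_⟩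
  intro x R h hR hx hh0 hhK
  have hx2 : 2 ≤ x := hR.trans hx
  have hL0 : 0 < Real.log R := Real.log_pos (by linarith)
  have hX0 : 0 < Real.log x := Real.log_pos (by linarith)
  set g : ℕ → ℝ := fun p => if (p : ℝ) ≤ R then h p else 1 with hg
  have hg0 : ∀ p, 0 ≤ g p := fun p => by
    simp only [hg]; split_ifs; exacts [hh0 p, zero_le_one]
  have hgK : ∀ p, g p ≤ K₁ := fun p => by
    simp only [hg]; split_ifs; exacts [(hhK p).trans (le_max_left _ _), hK₁1]
  have h1 := log_mul_sum_prod_primeFactors_le hK₁1 hg0 hgK (by linarith : 1 ≤ x)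
  have h2 := sum_prod_primeFactors_div_le_prod hg0 ⌊x⌋₊
  have hbelow : (⌊x⌋₊ + 1).primesBelow = primesUpTo x := by
    ext p
    rw [Nat.mem_primesBelow, mem_primesUpTo, Nat.lt_succ_iff]
    constructor
    · rintro ⟨a, b⟩; exact ⟨b, (Nat.le_floor_iff (by linarith)).mp a⟩
    · rintro ⟨a, b⟩; exact ⟨(Nat.le_floor_iff (by linarith)).mpr b, a⟩
  have h3 : ∏ p ∈ (⌊x⌋₊ + 1).primesBelow, (1 + g p / (p - 1)) ≤
      Real.exp (∑ p ∈ primesUpTo x, g p / p + K₁) := by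
    have h4 : ∏ p ∈ (⌊x⌋₊ + 1).primesBelow, (1 + g p / ((p : ℝ) - 1)) ≤
        ∏ p ∈ (⌊x⌋₊ + 1).primesBelow, Real.exp (g p / p + K₁ * (1 / (p * (p - 1)))) := by
      refine Finset.prod_le_prod (fun p hp => ?_) fun p hp => ?_
      all_goals
        have hp2 : (2 : ℝ) ≤ p := by exact_mod_cast (Nat.prime_of_mem_primesBelow hp).two_le
        have hp1 : (0 : ℝ) < p - 1 := by linarith
        have := hg0 p
      · positivity
      · have e : g p / (p - 1) = g p / p + g p * (1 / (p * (p - 1))) := by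
          field_simp; ring
        have e2 : g p * (1 / ((p : ℝ) * (p - 1))) ≤ K₁ * (1 / (p * (p - 1))) := by
          gcongr; exact hgK p
        rw [e]
        have := Real.add_one_le_exp (g p / p + K₁ * (1 / ((p : ℝ) * (p - 1))))
        linarith
    refine h4.trans ?_
    rw [← Real.exp_sum, Finset.sum_add_distrib, ← Finset.mul_sum, Real.exp_le_exp, hbelow]
    have := sum_inv_mul_pred_primesBelow_le (⌊x⌋₊ + 1)
    rw [hbelow] at this
    nlinarith
  have h5 : ∑ p ∈ primesUpTo x, g p / p ≤ ∑ p ∈ primesUpTo R, h p / p +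
      (Real.log (Real.log x) - Real.log (Real.log R) + 2 * C) := by
    have hsub : primesUpTo R ⊆ primesUpTo x := fun p hp => by
      rw [mem_primesUpTo] at *
      exact ⟨hp.1, hp.2.trans hx⟩
    have a := hC R 0 hR
    have b := hC x 0 hx2
    simp only [zero_mul, Real.cos_zero, abs_zero, add_zero, Real.log_one, mul_zero,
      min_eq_left (zero_le_one' ℝ), one_div, Real.log_inv] at a b
    have e1 := Finset.sum_sdiff hsub (f := fun p : ℕ => g p / (p : ℝ))
    have e2 := Finset.sum_sdiff hsub (f := fun p : ℕ => ((p : ℝ))⁻¹)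
    have e3 : ∑ p ∈ primesUpTo x \ primesUpTo R, g p / (p : ℝ) =
        ∑ p ∈ primesUpTo x \ primesUpTo R, ((p : ℝ))⁻¹ := by
      refine Finset.sum_congr rfl fun p hp => ?_
      rw [Finset.mem_sdiff, mem_primesUpTo, mem_primesUpTo] at hp
      have : ¬ (p : ℝ) ≤ R := fun h => hp.2 ⟨hp.1.1, h⟩
      simp [hg, this]
    have e4 : ∑ p ∈ primesUpTo R, g p / (p : ℝ) = ∑ p ∈ primesUpTo R, h p / (p : ℝ) := by
      refine Finset.sum_congr rfl fun p hp => ?_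
      simp [hg, (mem_primesUpTo.mp hp).2]
    rw [abs_le] at a b
    linarith [a.1, a.2, b.1, b.2]
  have hHeq : ∀ n : ℕ, ∏ p ∈ n.primeFactors with ((p : ℕ) : ℝ) ≤ R, h p =
      ∏ p ∈ n.primeFactors, g p := fun n => Finset.prod_filter _ _
  simp only [hHeq]
  set S := ∑ n ∈ Finset.Icc 1 ⌊x⌋₊, ∏ p ∈ n.primeFactors, g p with hS
  have h6 : ∑ n ∈ Finset.Icc 1 ⌊x⌋₊, (∏ p ∈ n.primeFactors, g p) / (n : ℝ) ≤
      Real.exp (∑ p ∈ primesUpTo R, h p / p) * (Real.log x / Real.log R) *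
        Real.exp (K₁ + 2 * C) := by
    refine (h2.trans h3).trans ?_
    refine (Real.exp_le_exp.mpr (add_le_add_left h5 K₁)).trans (le_of_eq ?_)
    rw [← Real.exp_log hX0, ← Real.exp_log hL0]
    simp only [Real.log_exp]
    rw [← Real.exp_sub, ← Real.exp_add, ← Real.exp_add]
    congr 1
    ring
  have h7 : Real.log x * S ≤ Real.log x * ((1 + K₁ * (Real.log 4 + 4)) * Real.exp (K₁ + 2 * C) *
      (x / Real.log R) * Real.exp (∑ p ∈ primesUpTo R, h p / p)) := by
    refine h1.trans ?_
    refine (mul_le_mul_of_nonneg_left h6 (by positivity)).trans (le_of_eq ?_)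
    ring
  exact le_of_mul_le_mul_left h7 hX0

theorem two_sub_two_cos_pow (r : ℕ) (θ : ℝ) :
    (2 - 2 * Real.cos θ) ^ r = ∑ j ∈ Finset.range (2 * r + 1),
      (-1) ^ (j + r) * ((2 * r).choose j : ℝ) * Real.cos (((j : ℝ) - r) * θ) := by
  set z : ℂ := Complex.exp (θ * Complex.I) with hz
  have hz0 : z ≠ 0 := Complex.exp_ne_zero _
  have h1 : ((2 - 2 * Real.cos θ : ℝ) : ℂ) = -(z⁻¹ * (-z + 1) ^ 2) := by
    have h2 : (2 : ℂ) * Complex.cos θ = z + z⁻¹ := by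
      rw [Complex.two_cos, hz, ← Complex.exp_neg, neg_mul]
    push_cast
    rw [h2]
    field_simp
    ring
  have h3 : ((2 - 2 * Real.cos θ : ℝ) : ℂ) ^ r = ∑ j ∈ Finset.range (2 * r + 1),
      (((-1) ^ (j + r) * ((2 * r).choose j : ℝ) : ℝ) : ℂ) * (z⁻¹ ^ r * z ^ j) := by
    rw [h1, neg_pow, mul_pow, ← pow_mul, add_pow, Finset.mul_sum, Finset.mul_sum]
    refine Finset.sum_congr rfl fun j _ => ?_
    push_cast
    rw [neg_pow z, one_pow]
    ring
  have h4 : ∀ j : ℕ, (z⁻¹ ^ r * z ^ j).re = Real.cos (((j : ℝ) - r) * θ) := by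
    intro j
    have : z⁻¹ ^ r * z ^ j = Complex.exp (((((j : ℝ) - r) * θ : ℝ) : ℂ) * Complex.I) := by
      rw [hz, ← Complex.exp_neg, ← Complex.exp_nat_mul, ← Complex.exp_nat_mul, ← Complex.exp_add]
      congr 1
      push_cast
      ring
    rw [this, Complex.exp_ofReal_mul_I_re]
  have h5 := congrArg Complex.re h3
  rw [← Complex.ofReal_pow, Complex.ofReal_re, Complex.re_sum] at h5
  rw [h5]
  refine Finset.sum_congr rfl fun j _ => ?_
  rw [Complex.re_ofReal_mul, h4]

/-- The product `∏ |1 - p^{it}|` over the prime factors `p ≤ R` of `n`. -/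
noncomputable def sinProd (R : ℝ) (n : ℕ) (t : ℝ) : ℝ :=
  ∏ p ∈ n.primeFactors with ((p : ℕ) : ℝ) ≤ R, 2 * |Real.sin (t * Real.log p / 2)|

theorem sinProd_nonneg (R : ℝ) (n : ℕ) (t : ℝ) : 0 ≤ sinProd R n t :=
  Finset.prod_nonneg fun _ _ => by positivity

theorem continuous_sinProd (R : ℝ) (n : ℕ) : Continuous (sinProd R n) := by
  unfold sinProd
  fun_prop

theorem sinProd_sq (R : ℝ) (n : ℕ) (t : ℝ) : sinProd R n t ^ 2 =
    ∏ p ∈ n.primeFactors with ((p : ℕ) : ℝ) ≤ R, (2 - 2 * Real.cos (t * Real.log p)) := by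
  rw [sinProd, ← Finset.prod_pow]
  refine Finset.prod_congr rfl fun p _ => ?_
  rw [mul_pow, sq_abs, Real.sin_sq_eq_half_sub]
  ring_nf

theorem abs_log_add_min_sub_le {η a u c : ℝ} (hη : 0 < η) (ha : 0 < a) (hc : 1 ≤ c)
    (h1 : a ≤ c * u) (h2 : u ≤ c * a) :
    |Real.log (η + min u 1) - Real.log (η + min a 1)| ≤ Real.log c := by
  have hu : 0 < u := by
    by_contra h
    push Not at h
    nlinarith
  have hm : ∀ v w : ℝ, 0 < v → 0 < w → v ≤ c * w → min v 1 ≤ c * min w 1 := by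
    intro v w hv hw hvw
    rcases le_total w 1 with h | h
    · rw [min_eq_left h]; exact (min_le_left _ _).trans hvw
    · rw [min_eq_right h]; exact (min_le_right _ _).trans (by linarith)
  have hpos : ∀ v : ℝ, 0 < v → 0 < η + min v 1 := fun v hv =>
    add_pos hη (lt_min hv one_pos)
  have hl : ∀ v w : ℝ, 0 < v → 0 < w → v ≤ c * w →
      Real.log (η + min v 1) ≤ Real.log c + Real.log (η + min w 1) := by
    intro v w hv hw hvw
    rw [← Real.log_mul (by linarith) (hpos w hw).ne']
    refine Real.log_le_log (hpos v hv) ?_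
    have := hm v w hv hw hvw
    nlinarith
  have a1 := hl u a hu ha h2
  have a2 := hl a u ha hu h1
  rw [abs_le]
  constructor <;> linarith

theorem sum_primes_two_point (R t t' : ℝ) (r : ℕ) (Λ : ℝ) :
    ∑ p ∈ primesUpTo R, ((2 - 2 * Real.cos (t * Real.log p)) *
        (2 - 2 * Real.cos (t' * Real.log p)) ^ r) / p =
      ∑ j ∈ Finset.range (2 * r + 1), (-1) ^ (j + r) * ((2 * r).choose j : ℝ) *
        (2 * (∑ p ∈ primesUpTo R, Real.cos ((((j : ℝ) - r) * t') * Real.log p) / p + Λ) -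
          (∑ p ∈ primesUpTo R, Real.cos ((((j : ℝ) - r) * t' + t) * Real.log p) / p + Λ) -
          (∑ p ∈ primesUpTo R, Real.cos ((((j : ℝ) - r) * t' - t) * Real.log p) / p + Λ)) := by
  have h1 : ∀ j : ℕ,
      (2 * (∑ p ∈ primesUpTo R, Real.cos ((((j : ℝ) - r) * t') * Real.log p) / p + Λ) -
          (∑ p ∈ primesUpTo R, Real.cos ((((j : ℝ) - r) * t' + t) * Real.log p) / p + Λ) -
          (∑ p ∈ primesUpTo R, Real.cos ((((j : ℝ) - r) * t' - t) * Real.log p) / p + Λ)) =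
      ∑ p ∈ primesUpTo R, (2 - 2 * Real.cos (t * Real.log p)) *
        Real.cos (((j : ℝ) - r) * (t' * Real.log p)) / p := by
    intro j
    have h2 : ∀ p : ℕ, (2 - 2 * Real.cos (t * Real.log p)) *
        Real.cos (((j : ℝ) - r) * (t' * Real.log p)) / p =
        2 * (Real.cos ((((j : ℝ) - r) * t') * Real.log p) / p) -
          Real.cos ((((j : ℝ) - r) * t' + t) * Real.log p) / p -
          Real.cos ((((j : ℝ) - r) * t' - t) * Real.log p) / p := by
      intro p
      rw [add_mul, sub_mul (((j : ℝ) - r) * t'), Real.cos_add, Real.cos_sub, mul_assoc ((j : ℝ) - r)]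
      ring
    simp only [h2, Finset.sum_sub_distrib, ← Finset.mul_sum]
    ring
  simp only [h1, Finset.mul_sum]
  rw [Finset.sum_comm]
  refine Finset.sum_congr rfl fun p _ => ?_
  rw [two_sub_two_cos_pow, Finset.mul_sum, Finset.sum_div]
  exact Finset.sum_congr rfl fun j _ => by ring

set_option maxHeartbeats 1600000 in
theorem exists_sum_primes_two_point_le (s : ℕ) :
    ∃ C : ℝ, ∀ R a t t' : ℝ, 2 ≤ R → 0 < a → a ≤ t → t ≤ 3 / 2 * a → a ≤ t' → t' ≤ 3 / 2 * a →
      ∑ p ∈ primesUpTo R, ((2 - 2 * Real.cos (t * Real.log p)) *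
        (2 - 2 * Real.cos (t' * Real.log p)) ^ (s + 1)) / p ≤
      C + Real.log (1 + a) + (Nat.centralBinom (s + 2)) * Real.log (1 + Real.log R * min a 1) -
        2 * ((2 * (s + 1)).choose (s + 2)) * Real.log (1 + Real.log R * min |t - t'| 1) := by
  set r := s + 1 with hr
  set W : ℝ := 4 * 4 ^ r with hW
  have hW0 : 0 < W := by positivity
  obtain ⟨C, hC⟩ := abs_sum_primes_cos_div_add_log_le (show 0 < 1 / W by positivity)
  set c : ℝ := 2 * (r + 1) with hc
  have hr1 : (1 : ℝ) ≤ r := by rw [hr]; push_cast; linarith [(Nat.cast_nonneg s : (0 : ℝ) ≤ s)]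
  have hc1 : 4 ≤ c := by linarith
  refine ⟨W * (|C| + 1 / W * Real.log c + Real.log c), ?_⟩
  intro R a t t' hR ha hta hta2 hta' hta2'
  set L := Real.log R with hL
  have hL0 : 0 < L := Real.log_pos (by linarith)
  set Λ : ℝ := Real.log (1 / L + min a 1) with hΛ
  set ψ : ℝ → ℝ := fun u => ∑ p ∈ primesUpTo R, Real.cos (u * Real.log p) / p + Λ with hψ
  set E : ℝ := |C| + 1 / W * Real.log (1 + a) + 1 / W * Real.log c + Real.log c with hE
  set X : ℝ := Real.log (1 + L * min a 1) with hX
  set Y : ℝ := Real.log (1 + L * min |t - t'| 1) with hY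
  have hlogc : 0 ≤ Real.log c := Real.log_nonneg (by linarith)
  have hloga : 0 ≤ Real.log (1 + a) := Real.log_nonneg (by linarith)
  have hW' : 0 < 1 / W := by positivity
  have hCabs := le_abs_self C
  have hlog : ∀ u : ℝ, |u| ≤ c * a → 1 / W * Real.log (1 + |u|) ≤
      1 / W * Real.log (1 + a) + 1 / W * Real.log c := by
    intro u hu
    rw [← mul_add, ← Real.log_mul (by positivity) (by positivity)]
    have := abs_nonneg u
    gcongr
    nlinarith
  have hgen : ∀ u : ℝ, a ≤ c * |u| → |u| ≤ c * a → |ψ u| ≤ E := by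
    intro u h1 h2
    have h3 := abs_le.mp (abs_log_add_min_sub_le (η := 1 / L) (by positivity) ha (by linarith) h1 h2)
    have h4 := abs_le.mp (hC R u hR)
    have h5 := hlog u h2
    simp only [hψ, hE]
    rw [abs_le]
    constructor <;> linarith [h3.1, h3.2, h4.1, h4.2]
  have hfac : ∀ v : ℝ, 0 ≤ v → Real.log (1 / L + v) = Real.log (1 + L * v) - Real.log L := by
    intro v hv
    rw [← Real.log_div (by positivity) hL0.ne']
    congr 1
    field_simp
  have hmina : 0 ≤ min a 1 := le_min ha.le zero_le_one
  have hzero : ψ 0 ≤ X + E := by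
    have h4 := abs_le.mp (hC R 0 hR)
    simp only [abs_zero, min_eq_left (zero_le_one' ℝ), add_zero, Real.log_one, mul_zero] at h4
    have h5 := hfac (min a 1) hmina
    have h6 : Real.log (1 / L) = - Real.log L := by rw [one_div, Real.log_inv]
    simp only [hψ, hΛ, hX, hE]
    have := mul_nonneg hW'.le hlogc
    have := mul_nonneg hW'.le hloga
    linarith [h4.1, h4.2]
  have hdelta : ∀ u : ℝ, |u| = |t - t'| → ψ u ≤ X - Y + E := by
    intro u hu
    have hδ : |u| ≤ c * a := by
      rw [hu, abs_le]
      constructor <;> nlinarith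
    have h4 := abs_le.mp (hC R u hR)
    have h5 := hfac (min a 1) hmina
    have h6 := hfac (min |t - t'| 1) (le_min (abs_nonneg _) zero_le_one)
    have h7 := hlog u hδ
    rw [hu] at h4 h7
    simp only [hψ, hΛ, hX, hY, hE]
    linarith [h4.1, h4.2]
  have hfreq0 : ∀ j : ℕ, j ∈ Finset.range (2 * r + 1) → |(j : ℝ) - r| ≤ r := by
    intro j hj
    have : (j : ℝ) ≤ 2 * r := by
      have := Finset.mem_range.mp hj
      exact_mod_cast (by omega : j ≤ 2 * r)
    rw [abs_le]
    constructor <;> linarith [(Nat.cast_nonneg j : (0 : ℝ) ≤ j)]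
  have ht0 : 0 < t := by linarith
  have ht0' : 0 < t' := by linarith
  have hup : ∀ m v : ℝ, |m| ≤ r → |v| ≤ t → |m * t' + v| ≤ c * a := by
    intro m v hm hv
    refine (abs_add_le _ _).trans ?_
    rw [abs_mul, abs_of_pos ht0']
    have : |m| * t' ≤ r * (3 / 2 * a) := by gcongr
    nlinarith
  have hlow : ∀ m v : ℝ, |v| ≤ t → 2 ≤ |m| → a ≤ c * |m * t' + v| := by
    intro m v hv hm
    have h1 : |m| * t' - |v| ≤ |m * t' + v| := by
      have := abs_sub_abs_le_abs_sub (m * t') (-v)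
      rw [abs_neg, abs_mul, abs_of_pos ht0', sub_neg_eq_add] at this
      exact this
    have h2 : a / 2 ≤ |m * t' + v| := by nlinarith
    nlinarith
  have hmain : ∀ j ∈ Finset.range (2 * r + 1), (-1) ^ (j + r) * ((2 * r).choose j : ℝ) *
      (2 * ψ (((j : ℝ) - r) * t') - ψ (((j : ℝ) - r) * t' + t) - ψ (((j : ℝ) - r) * t' - t)) ≤
      ((2 * r).choose j : ℝ) * ((if j = r then 2 * X else 0) + (if j = r + 1 then X - Y else 0) +
        (if j = s then X - Y else 0) + 4 * E) := by
    intro j hj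
    have hm := hfreq0 j hj
    set m : ℝ := (j : ℝ) - r with hmdef
    have htt : |t| ≤ t := (abs_of_pos ht0).le
    have htt' : |-t| ≤ t := by rw [abs_neg]; exact htt
    have h00 : |(0 : ℝ)| ≤ t := by rw [abs_zero]; exact ht0.le
    have u1 := hup m 0 hm h00
    have u2 := hup m t hm htt
    have u3 := hup m (-t) hm htt'
    rw [add_zero] at u1
    rw [← sub_eq_add_neg] at u3
    by_cases j0 : j = r
    · have hm0 : m = 0 := by rw [hmdef, j0, sub_self]
      have e1 : ψ (0 * t') ≤ X + E := by rw [zero_mul]; exact hzero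
      have e2 := abs_le.mp (hgen (m * t' + t) (by rw [hm0, zero_mul, zero_add, abs_of_pos ht0]; nlinarith) u2)
      have e3 := abs_le.mp (hgen (m * t' - t)
        (by rw [hm0, zero_mul, zero_sub, abs_neg, abs_of_pos ht0]; nlinarith) u3)
      rw [hm0] at e2 e3 ⊢
      rw [if_pos j0, if_neg (by omega), if_neg (by omega), j0, Even.neg_one_pow ⟨r, rfl⟩, one_mul]
      gcongr
      linarith [e2.1, e3.1]
    by_cases j1 : j = r + 1
    · have hm1 : m = 1 := by rw [hmdef, j1]; push_cast; ring
      have e1 := abs_le.mp (hgen (m * t') (by rw [hm1, one_mul, abs_of_pos ht0']; nlinarith) u1)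
      have e2 := abs_le.mp (hgen (m * t' + t)
        (by rw [hm1, one_mul, abs_of_pos (by linarith)]; nlinarith) u2)
      have e3 := hdelta (m * t' - t) (by rw [hm1, one_mul, abs_sub_comm])
      rw [if_neg j0, if_pos j1, if_neg (by omega), Odd.neg_one_pow ⟨r, by omega⟩, mul_comm (-1 : ℝ),
        mul_assoc]
      gcongr
      linarith [e1.1, e2.2]
    by_cases j2 : j = s
    · have hm1 : m = -1 := by rw [hmdef, j2, hr]; push_cast; ring
      have e1 := abs_le.mp (hgen (m * t')
        (by rw [hm1, neg_one_mul, abs_neg, abs_of_pos ht0']; nlinarith) u1)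
      have e2 := abs_le.mp (hgen (m * t' - t)
        (by rw [hm1, neg_one_mul, ← neg_add', abs_neg, abs_of_pos (by linarith)]; nlinarith) u3)
      have e3 := hdelta (m * t' + t) (by rw [hm1]; congr 1; ring)
      rw [if_neg j0, if_neg j1, if_pos j2, Odd.neg_one_pow ⟨s, by omega⟩, mul_comm (-1 : ℝ),
        mul_assoc]
      gcongr
      linarith [e1.1, e2.2]
    have hm2 : 2 ≤ |m| := by
      have : (2 : ℤ) ≤ |(j : ℤ) - r| := by
        rcases abs_cases ((j : ℤ) - r) with ⟨h, _⟩ | ⟨h, _⟩ <;> omega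
      have h2 : ((2 : ℤ) : ℝ) ≤ ((|(j : ℤ) - r| : ℤ) : ℝ) := Int.cast_le.mpr this
      rw [hmdef]
      push_cast at h2
      exact h2
    have l1 := hlow m 0 h00 hm2
    have l2 := hlow m t htt hm2
    have l3 := hlow m (-t) htt' hm2
    rw [add_zero] at l1
    rw [← sub_eq_add_neg] at l3
    have e1 := abs_le.mp (hgen _ l1 u1)
    have e2 := abs_le.mp (hgen _ l2 u2)
    have e3 := abs_le.mp (hgen _ l3 u3)
    rw [if_neg j0, if_neg j1, if_neg j2]
    have hch : (0 : ℝ) ≤ (2 * r).choose j := Nat.cast_nonneg _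
    rcases neg_one_pow_eq_or ℝ (j + r) with h | h <;> rw [h]
    · rw [one_mul]
      gcongr
      linarith [e1.2, e2.1, e3.1]
    · rw [mul_comm (-1 : ℝ), mul_assoc]
      gcongr
      linarith [e1.1, e2.2, e3.2]
  rw [sum_primes_two_point R t t' r Λ]
  refine (Finset.sum_le_sum hmain).trans ?_
  have hsum4 : ∑ j ∈ Finset.range (2 * r + 1), ((2 * r).choose j : ℝ) = 4 ^ r := by
    have := Nat.sum_range_choose (2 * r)
    rw [pow_mul] at this
    exact_mod_cast this
  simp only [mul_add, mul_ite, mul_zero, Finset.sum_add_distrib, Finset.sum_ite_eq',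
    ← Finset.sum_mul, hsum4]
  rw [if_pos (Finset.mem_range.mpr (by omega)), if_pos (Finset.mem_range.mpr (by omega)),
    if_pos (Finset.mem_range.mpr (by omega))]
  have hsym : (2 * r).choose s = (2 * r).choose (r + 1) := by
    rw [← Nat.choose_symm (show s ≤ 2 * r by omega)]
    congr 1; omega
  have hcb : Nat.centralBinom (s + 2) = 2 * (2 * r).choose r + 2 * (2 * r).choose (r + 1) := by
    rw [Nat.centralBinom_eq_two_mul_choose, show s + 2 = r + 1 by omega,
      show 2 * (r + 1) = 2 * r + 1 + 1 by ring, Nat.choose_succ_succ,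
      show (2 * r + 1).choose (r + 1) = (2 * r + 1).choose r from by
        rw [← Nat.choose_symm (show r + 1 ≤ 2 * r + 1 by omega)]; congr 1; omega]
    have : (2 * r + 1).choose r = (2 * r).choose r + (2 * r).choose (r + 1) := by
      rw [← Nat.choose_succ_succ, ← Nat.choose_symm (show r + 1 ≤ 2 * r + 1 by omega)]
      congr 1; omega
    omega
  rw [hsym, hcb, show s + 2 = r + 1 by omega]
  have hWE : 4 ^ r * (4 * E) = W * (|C| + 1 / W * Real.log c + Real.log c) + Real.log (1 + a) := by
    have : W * (1 / W) = 1 := by field_simp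
    calc 4 ^ r * (4 * E) = W * E := by rw [hW]; ring
      _ = W * (|C| + 1 / W * Real.log c + Real.log c) + W * (1 / W) * Real.log (1 + a) := by
        rw [hE]; ring
      _ = _ := by rw [this, one_mul]
  push_cast
  linarith

/-- Asymmetric two-point correlation bound for `sinProd`. -/
theorem exists_sum_sinProd_sq_mul_pow_le (s : ℕ) :
    ∃ K : ℝ, 0 < K ∧ ∀ x R a t t' : ℝ, 2 ≤ R → R ≤ x → 0 < a → a ≤ t → t ≤ 3 / 2 * a →
      a ≤ t' → t' ≤ 3 / 2 * a →
      ∑ n ∈ Finset.Icc 1 ⌊x⌋₊, sinProd R n t ^ 2 * sinProd R n t' ^ (2 * (s + 1)) ≤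
        K * (x / Real.log R * (1 + a) * (1 + Real.log R * min a 1) ^ Nat.centralBinom (s + 2) *
          ((1 + Real.log R * min |t - t'| 1) ^ (2 * (2 * (s + 1)).choose (s + 2)))⁻¹) := by
  obtain ⟨C, hC⟩ := exists_sum_primes_two_point_le s
  obtain ⟨K, hK, hM⟩ := exists_sum_prod_primeFactors_filter_le (4 * 4 ^ (s + 1))
  refine ⟨K * Real.exp C, by positivity, ?_⟩
  intro x R a t t' hR hRx ha h1 h2 h3 h4
  have hL0 : 0 < Real.log R := Real.log_pos (by linarith)
  have hc : ∀ θ : ℝ, 0 ≤ 2 - 2 * Real.cos θ ∧ 2 - 2 * Real.cos θ ≤ 4 := fun θ => by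
    constructor <;> linarith [Real.cos_le_one θ, Real.neg_one_le_cos θ]
  have h5 := hM x R (fun p => (2 - 2 * Real.cos (t * Real.log p)) *
      (2 - 2 * Real.cos (t' * Real.log p)) ^ (s + 1)) hR hRx
      (fun p => mul_nonneg (hc _).1 (pow_nonneg (hc _).1 _))
      (fun p => mul_le_mul (hc _).2 (pow_le_pow_left₀ (hc _).1 (hc _).2 _)
        (pow_nonneg (hc _).1 _) (by norm_num))
  have h6 := Real.exp_le_exp.mpr (hC R a t t' hR ha h1 h2 h3 h4)
  have e1 : ∀ n : ℕ, sinProd R n t ^ 2 * sinProd R n t' ^ (2 * (s + 1)) =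
      ∏ p ∈ n.primeFactors with ((p : ℕ) : ℝ) ≤ R, ((2 - 2 * Real.cos (t * Real.log p)) *
      (2 - 2 * Real.cos (t' * Real.log p)) ^ (s + 1)) := by
    intro n
    rw [pow_mul, sinProd_sq, sinProd_sq, ← Finset.prod_pow, ← Finset.prod_mul_distrib]
  simp only [e1]
  refine h5.trans ?_
  have hX : 0 < 1 + Real.log R * min a 1 := by
    have : 0 ≤ min a 1 := le_min ha.le zero_le_one
    positivity
  have hY : 0 < 1 + Real.log R * min |t - t'| 1 := by
    have : 0 ≤ min |t - t'| 1 := le_min (abs_nonneg _) zero_le_one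
    positivity
  rw [Real.exp_sub, Real.exp_add, Real.exp_add, Real.exp_log (by positivity)] at h6
  have e2 : Real.exp ((Nat.centralBinom (s + 2)) * Real.log (1 + Real.log R * min a 1)) =
      (1 + Real.log R * min a 1) ^ Nat.centralBinom (s + 2) := by
    rw [Real.exp_nat_mul, Real.exp_log hX]
  have e3 : Real.exp (2 * ((2 * (s + 1)).choose (s + 2)) *
      Real.log (1 + Real.log R * min |t - t'| 1)) =
      (1 + Real.log R * min |t - t'| 1) ^ (2 * (2 * (s + 1)).choose (s + 2)) := by
    rw [← Nat.cast_ofNat, ← Nat.cast_mul, Real.exp_nat_mul, Real.exp_log hY]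
  rw [e2, e3] at h6
  have hx0 : 0 < x := by linarith
  refine (mul_le_mul_of_nonneg_left h6 (by positivity)).trans (le_of_eq ?_)
  rw [div_eq_mul_inv (_ * _ * _)]
  ring

open MeasureTheory in
/-- Weighted Hölder inequality for a power of a lower Lebesgue integral. -/
theorem lintegral_pow_succ_le {α : Type*} [MeasurableSpace α] {μ : Measure α} (m : ℕ)
    {F W : α → ENNReal} (hF : Measurable F) (hW : Measurable W) (h0 : ∀ t, W t ≠ 0)
    (htop : ∀ t, W t ≠ ⊤) :
    (∫⁻ t, F t ∂μ) ^ (m + 1) ≤ (∫⁻ t, W t ∂μ) ^ m * ∫⁻ t, F t ^ (m + 1) * (W t ^ m)⁻¹ ∂μ := by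
  have hm : (0 : ℝ) < (m : ℝ) + 1 := by positivity
  have h := ENNReal.lintegral_mul_norm_pow_le (μ := μ)
    (f := fun t => F t ^ (m + 1) * (W t ^ m)⁻¹) (g := W) (p := 1 / ((m : ℝ) + 1))
    (q := (m : ℝ) / ((m : ℝ) + 1)) (by fun_prop) hW.aemeasurable (by positivity)
    (by positivity) (by field_simp; ring)
  have e : ∀ t, (F t ^ (m + 1) * (W t ^ m)⁻¹) ^ (1 / ((m : ℝ) + 1)) *
      W t ^ ((m : ℝ) / ((m : ℝ) + 1)) = F t := by
    intro t
    rw [ENNReal.mul_rpow_of_nonneg _ _ (by positivity), ENNReal.inv_rpow, ← ENNReal.rpow_natCast,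
      ← ENNReal.rpow_natCast, ← ENNReal.rpow_mul, ← ENNReal.rpow_mul, mul_assoc, mul_one_div,
      mul_one_div, ENNReal.inv_mul_cancel, mul_one]
    · push_cast
      rw [div_self hm.ne', ENNReal.rpow_one]
    · exact (ENNReal.rpow_pos (pos_iff_ne_zero.2 (h0 t)) (htop t)).ne'
    · exact ENNReal.rpow_ne_top_of_nonneg (by positivity) (htop t)
  simp only [e] at h
  refine (pow_le_pow_left' h (m + 1)).trans (le_of_eq ?_)
  rw [mul_pow, ← ENNReal.rpow_natCast, ← ENNReal.rpow_natCast, ← ENNReal.rpow_mul,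
    ← ENNReal.rpow_mul]
  push_cast
  rw [one_div_mul_cancel hm.ne', ENNReal.rpow_one, div_mul_cancel₀ _ hm.ne', ENNReal.rpow_natCast,
    mul_comm]

open MeasureTheory in
theorem lintegral_mul_le_of_sq_le {α : Type*} [MeasurableSpace α] {μ : Measure α}
    {F G : α → ENNReal} (hF : Measurable F) (hG : Measurable G) {B : ENNReal}
    (h1 : ∫⁻ t, F t ^ 2 ∂μ ≤ B) (h2 : ∫⁻ t, G t ^ 2 ∂μ ≤ B) : ∫⁻ t, F t * G t ∂μ ≤ B := by
  have h := ENNReal.lintegral_mul_norm_pow_le (μ := μ) (f := fun t => F t ^ 2)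
    (g := fun t => G t ^ 2) (p := 1 / 2) (q := 1 / 2) (by fun_prop) (by fun_prop) (by norm_num)
    (by norm_num) (by norm_num)
  have e : ∀ a : ENNReal, (a ^ 2) ^ (1 / 2 : ℝ) = a := by
    intro a
    rw [← ENNReal.rpow_natCast, ← ENNReal.rpow_mul]
    norm_num
  simp only [e] at h
  refine h.trans ((mul_le_mul' (ENNReal.rpow_le_rpow h1 (by norm_num))
    (ENNReal.rpow_le_rpow h2 (by norm_num))).trans (le_of_eq ?_))
  rw [← ENNReal.rpow_add_of_nonneg _ _ (by norm_num) (by norm_num)]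
  norm_num

theorem sum_mul_le_of_sum_sq_le {ι : Type*} (S : Finset ι) {f g : ι → ENNReal} {a b : ENNReal}
    (h1 : ∑ i ∈ S, f i ^ 2 ≤ a ^ 2) (h2 : ∑ i ∈ S, g i ^ 2 ≤ b ^ 2) :
    ∑ i ∈ S, f i * g i ≤ a * b := by
  have h := ENNReal.inner_le_Lp_mul_Lq S f g (p := 2) (q := 2) Real.HolderConjugate.two_two
  have e : ∀ a : ENNReal, (a ^ 2) ^ (1 / 2 : ℝ) = a := by
    intro a
    rw [← ENNReal.rpow_natCast, ← ENNReal.rpow_mul]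
    norm_num
  simp only [ENNReal.rpow_two] at h
  refine h.trans (mul_le_mul' ?_ ?_)
  · simpa only [e] using ENNReal.rpow_le_rpow h1 (z := 1 / 2) (by norm_num)
  · simpa only [e] using ENNReal.rpow_le_rpow h2 (z := 1 / 2) (by norm_num)

open MeasureTheory in
/-- A high moment of integrals is controlled by two-point correlations. -/
theorem sum_lintegral_pow_le {α ι : Type*} [MeasurableSpace α] {μ : Measure α} [SFinite μ]
    (S : Finset ι) {X : ι → α → ENNReal} (hX : ∀ n, Measurable (X n)) (r : ℕ)
    {V : α → α → ENNReal} (hV : Measurable (Function.uncurry V)) (hV0 : ∀ s t, V s t ≠ 0)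
    (hVtop : ∀ s t, V s t ≠ ⊤) (hsymm : ∀ s t, V s t = V t s) {κ B : ENNReal}
    (hXV : ∀ s t, ∑ n ∈ S, X n s ^ 2 * X n t ^ (r + 1) ≤ κ * V s t ^ (2 * (r + 2)))
    (hB : ∀ s, ∫⁻ t, V s t ^ 2 ∂μ ≤ B) :
    ∑ n ∈ S, (∫⁻ t, X n t ∂μ) ^ (r + 3) ≤ κ * B ^ (r + 2) * μ Set.univ := by
  have hV1 : ∀ s, Measurable (V s) := fun s => hV.of_uncurry_left
  have hV2 : ∀ t, Measurable fun s => V s t := fun t => hV.of_uncurry_right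
  have hXsq : ∀ s t, ∑ n ∈ S, (X n s * (X n t ^ (r + 1)) ^ (1 / 2 : ℝ)) ^ 2 ≤
      ((κ ^ (1 / 2 : ℝ)) * V s t ^ (r + 2)) ^ 2 := by
    intro s t
    have e : ∀ a : ENNReal, (a ^ (1 / 2 : ℝ)) ^ 2 = a := by
      intro a
      rw [← ENNReal.rpow_natCast, ← ENNReal.rpow_mul]
      norm_num
    simp only [mul_pow, e]
    refine (hXV s t).trans (le_of_eq ?_)
    rw [← pow_mul, mul_comm 2]
  have h3 : ∀ s s' t, ∑ n ∈ S, X n s * X n s' * X n t ^ (r + 1) ≤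
      κ * (V s t * V s' t) ^ (r + 2) := by
    intro s s' t
    have e : ∀ a : ENNReal, (a ^ (1 / 2 : ℝ)) * (a ^ (1 / 2 : ℝ)) = a := by
      intro a
      rw [← ENNReal.rpow_add_of_nonneg _ _ (by norm_num) (by norm_num)]
      norm_num
    refine le_trans (le_of_eq ?_) ((sum_mul_le_of_sum_sq_le S (hXsq s t) (hXsq s' t)).trans
      (le_of_eq ?_))
    · refine Finset.sum_congr rfl fun n _ => ?_
      rw [mul_mul_mul_comm, e]
    · rw [mul_mul_mul_comm, e, mul_pow]
  have h4 : ∀ n s s', (∫⁻ t, X n t ∂μ) ^ (r + 1) ≤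
      B ^ r * ∫⁻ t, X n t ^ (r + 1) * ((V s t * V s' t) ^ r)⁻¹ ∂μ := by
    intro n s s'
    refine (lintegral_pow_succ_le r (hX n) ((hV1 s).mul (hV1 s'))
      (fun t => mul_ne_zero (hV0 _ _) (hV0 _ _))
      (fun t => ENNReal.mul_ne_top (hVtop _ _) (hVtop _ _))).trans ?_
    exact mul_le_mul' (pow_le_pow_left' (lintegral_mul_le_of_sq_le (hV1 s) (hV1 s') (hB s) (hB s'))
      r) le_rfl
  have hm3 : ∀ n s, Measurable (Function.uncurry fun s' t =>
      X n s * X n s' * X n t ^ (r + 1) * ((V s t * V s' t) ^ r)⁻¹) := by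
    intro n s
    have a1 : Measurable fun p : α × α => X n p.1 := (hX n).comp measurable_fst
    have a2 : Measurable fun p : α × α => X n p.2 := (hX n).comp measurable_snd
    have a3 : Measurable fun p : α × α => V s p.2 := (hV1 s).comp measurable_snd
    have a4 : Measurable fun p : α × α => V p.1 p.2 := hV
    simp only [Function.uncurry_def]
    fun_prop
  have hm4 : ∀ n, Measurable (fun p : (α × α) × α =>
      X n p.1.1 * X n p.1.2 * X n p.2 ^ (r + 1) * ((V p.1.1 p.2 * V p.1.2 p.2) ^ r)⁻¹) := by
    intro n
    have a1 : Measurable fun p : (α × α) × α => X n p.1.1 :=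
      (hX n).comp (measurable_fst.comp measurable_fst)
    have a2 : Measurable fun p : (α × α) × α => X n p.2 := (hX n).comp measurable_snd
    have a5 : Measurable fun p : (α × α) × α => X n p.1.2 :=
      (hX n).comp (measurable_snd.comp measurable_fst)
    have a3 : Measurable fun p : (α × α) × α => V p.1.1 p.2 :=
      hV.comp ((measurable_fst.comp measurable_fst).prodMk measurable_snd)
    have a4 : Measurable fun p : (α × α) × α => V p.1.2 p.2 :=
      hV.comp ((measurable_snd.comp measurable_fst).prodMk measurable_snd)
    fun_prop
  have hmI : ∀ n, Measurable fun p : α × α => ∫⁻ t, X n p.1 * X n p.2 * X n t ^ (r + 1) *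
      ((V p.1 t * V p.2 t) ^ r)⁻¹ ∂μ := fun n => (hm4 n).lintegral_prod_right'
  have hmJ : ∀ n s, Measurable fun s' => ∫⁻ t, X n s * X n s' * X n t ^ (r + 1) *
      ((V s t * V s' t) ^ r)⁻¹ ∂μ := fun n s => (hm3 n s).lintegral_prod_right'
  have h5 : ∀ n, (∫⁻ t, X n t ∂μ) ^ (r + 3) ≤ B ^ r * ∫⁻ s, ∫⁻ s', ∫⁻ t,
      X n s * X n s' * X n t ^ (r + 1) * ((V s t * V s' t) ^ r)⁻¹ ∂μ ∂μ ∂μ := by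
    intro n
    have e : (∫⁻ t, X n t ∂μ) ^ (r + 3) = ∫⁻ s, ∫⁻ s', X n s * X n s' *
        (∫⁻ t, X n t ∂μ) ^ (r + 1) ∂μ ∂μ := by
      have : ∀ s, ∫⁻ s', X n s * X n s' * (∫⁻ t, X n t ∂μ) ^ (r + 1) ∂μ =
          X n s * (∫⁻ t, X n t ∂μ) ^ (r + 2) := by
        intro s
        rw [lintegral_mul_const _ ((hX n).const_mul _), lintegral_const_mul _ (hX n)]
        ring
      simp only [this]
      rw [lintegral_mul_const _ (hX n)]
      ring
    rw [e, ← lintegral_const_mul _ (hmI n).lintegral_prod_right']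
    refine lintegral_mono fun s => ?_
    dsimp only
    rw [← lintegral_const_mul _ (hmJ n s)]
    refine lintegral_mono fun s' => ?_
    dsimp only
    refine (mul_le_mul' le_rfl (h4 n s s')).trans (le_of_eq ?_)
    have a3 := hV1 s
    have a4 := hV1 s'
    have a5 := hX n
    simp only [mul_assoc (X n s * X n s')]
    rw [lintegral_const_mul _ (by fun_prop)]
    ring
  refine (Finset.sum_le_sum fun n _ => h5 n).trans ?_
  rw [← Finset.mul_sum, ← lintegral_finsetSum _ fun n _ => (hmI n).lintegral_prod_right']
  have h6 : ∀ s, ∑ n ∈ S, ∫⁻ s', ∫⁻ t, X n s * X n s' * X n t ^ (r + 1) *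
      ((V s t * V s' t) ^ r)⁻¹ ∂μ ∂μ ≤ κ * B ^ 2 := by
    intro s
    rw [← lintegral_finsetSum _ fun n _ => hmJ n s]
    have h7 : ∀ s', ∑ n ∈ S, ∫⁻ t, X n s * X n s' * X n t ^ (r + 1) *
        ((V s t * V s' t) ^ r)⁻¹ ∂μ ≤ ∫⁻ t, κ * V s t ^ 2 * V s' t ^ 2 ∂μ := by
      intro s'
      rw [← lintegral_finsetSum _ fun n _ => (hm3 n s).of_uncurry_left]
      refine lintegral_mono fun t => ?_
      rw [← Finset.sum_mul]
      refine (mul_le_mul' (h3 s s' t) le_rfl).trans (le_of_eq ?_)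
      have hne : (V s t * V s' t) ^ r ≠ 0 := pow_ne_zero _ (mul_ne_zero (hV0 _ _) (hV0 _ _))
      have hnt : (V s t * V s' t) ^ r ≠ ⊤ :=
        ENNReal.pow_ne_top (ENNReal.mul_ne_top (hVtop _ _) (hVtop _ _))
      rw [add_comm r 2, pow_add, ← mul_assoc, mul_assoc (κ * _), ENNReal.mul_inv_cancel hne hnt]
      ring
    refine (lintegral_mono h7).trans ?_
    rw [lintegral_lintegral_swap]
    · have a3 := hV1 s
      have : ∀ t, ∫⁻ s', κ * V s t ^ 2 * V s' t ^ 2 ∂μ ≤ κ * V s t ^ 2 * B := by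
        intro t
        rw [lintegral_const_mul _ ((hV2 t).pow_const 2)]
        refine mul_le_mul' le_rfl ?_
        simpa only [hsymm t] using hB t
      refine (lintegral_mono this).trans ?_
      rw [lintegral_mul_const _ (by fun_prop), lintegral_const_mul _ (by fun_prop)]
      calc κ * (∫⁻ t, V s t ^ 2 ∂μ) * B ≤ κ * B * B := by gcongr; exact hB s
        _ = κ * B ^ 2 := by ring
    · have a3 : Measurable fun p : α × α => V s p.2 := (hV1 s).comp measurable_snd
      have a4 : Measurable fun p : α × α => V p.1 p.2 := hV
      simp only [Function.uncurry_def]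
      fun_prop
  refine (mul_le_mul' le_rfl (lintegral_mono h6)).trans (le_of_eq ?_)
  rw [lintegral_const]
  ring

theorem integrable_inv_one_add_abs_pow {A : ℕ} (hA : 2 ≤ A) :
    MeasureTheory.Integrable fun ξ : ℝ => ((1 + |ξ|) ^ A)⁻¹ := by
  have h := integrable_one_add_norm (E := ℝ) (μ := MeasureTheory.volume) (r := A)
    (by rw [Module.finrank_self]; exact_mod_cast hA)
  refine h.congr (Filter.Eventually.of_forall fun ξ => ?_)
  dsimp only
  rw [Real.norm_eq_abs, Real.rpow_neg (by positivity), Real.rpow_natCast]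

open FourierTransform in
theorem norm_fourier_le_of_contDiff {A : ℕ} {h : ℝ → ℂ} (hc : ContDiff ℝ A h)
    (hs : HasCompactSupport h) :
    ∃ G : ℝ, 0 < G ∧ ∀ ξ : ℝ, ‖𝓕 h ξ‖ ≤ G * ((1 + |ξ|) ^ A)⁻¹ := by
  have hintb : ∀ n : ℕ, n ≤ A → MeasureTheory.Integrable (iteratedDeriv n h) := by
    intro n hn
    refine (hc.continuous_iteratedDeriv n (by exact_mod_cast hn)).integrable_of_hasCompactSupport ?_
    rw [iteratedDeriv_eq_equiv_comp]
    exact (hs.iteratedFDeriv n).comp_left (map_zero _)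
  have hA := Real.fourier_iteratedDeriv (N := (A : ℕ∞)) (n := A) (f := h) (by exact_mod_cast hc)
    (fun n hn => hintb n (by exact_mod_cast hn)) le_rfl
  have hb : ∀ (g : ℝ → ℂ) (ξ : ℝ), ‖𝓕 g ξ‖ ≤ ∫ v, ‖g v‖ := fun g ξ =>
    VectorFourier.norm_fourierIntegral_le_integral_norm _ _ _ g ξ
  set I0 := ∫ v, ‖h v‖
  set I1 := ∫ v, ‖iteratedDeriv A h v‖
  have hI0 : 0 ≤ I0 := MeasureTheory.integral_nonneg fun v => norm_nonneg _
  have hI1 : 0 ≤ I1 := MeasureTheory.integral_nonneg fun v => norm_nonneg _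
  refine ⟨2 ^ A * (I0 + I1 + 1), by positivity, ?_⟩
  intro ξ
  have h0 := hb h ξ
  have h1 := hb (iteratedDeriv A h) ξ
  rw [hA] at h1
  dsimp only at h1
  rw [norm_smul, norm_pow] at h1
  have e : ‖(2 * (Real.pi : ℂ) * Complex.I * ξ)‖ = 2 * Real.pi * |ξ| := by
    simp [abs_of_pos Real.pi_pos]
  rw [e] at h1
  rw [← div_eq_mul_inv, le_div_iff₀ (by positivity)]
  have h2 : |ξ| ^ A ≤ (2 * Real.pi * |ξ|) ^ A := by
    gcongr
    have := Real.pi_gt_three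
    nlinarith [abs_nonneg ξ]
  have h3 : (1 + |ξ|) ^ A ≤ 2 ^ A * (1 + |ξ| ^ A) := by
    rcases le_total |ξ| 1 with h | h
    · calc (1 + |ξ|) ^ A ≤ 2 ^ A := by gcongr; linarith
        _ ≤ 2 ^ A * (1 + |ξ| ^ A) := le_mul_of_one_le_right (by positivity)
            (by linarith [pow_nonneg (abs_nonneg ξ) A])
    · calc (1 + |ξ|) ^ A ≤ (2 * |ξ|) ^ A := by gcongr; linarith
        _ = 2 ^ A * |ξ| ^ A := mul_pow _ _ _
        _ ≤ 2 ^ A * (1 + |ξ| ^ A) := by gcongr; linarith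
  calc ‖𝓕 h ξ‖ * (1 + |ξ|) ^ A ≤ ‖𝓕 h ξ‖ * (2 ^ A * (1 + (2 * Real.pi * |ξ|) ^ A)) := by
        gcongr
        refine h3.trans ?_
        gcongr
    _ = 2 ^ A * (‖𝓕 h ξ‖ + (2 * Real.pi * |ξ|) ^ A * ‖𝓕 h ξ‖) := by ring
    _ ≤ 2 ^ A * (I0 + I1 + 1) := mul_le_mul_of_nonneg_left (by linarith) (by positivity)

open FourierTransform in
/-- On `[0, ∞)`, a `C^A` function vanishing beyond `1` is a Fourier integral with density decaying
like `(1 + |ξ|)^{-A}`. -/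
theorem exists_fourier_density {A : ℕ} (hA2 : 2 ≤ A) {f : ℝ → ℝ} (hsupp : ∀ t : ℝ, 1 < t → f t = 0)
    (hsmooth : ContDiff ℝ A f) :
    ∃ (g : ℝ → ℂ) (G : ℝ), 0 < G ∧ Continuous g ∧ (∀ ξ, ‖g ξ‖ ≤ G * ((1 + |ξ|) ^ A)⁻¹) ∧
      ∀ u : ℝ, 0 ≤ u →
        (f u : ℂ) = ∫ ξ : ℝ, Complex.exp (2 * Real.pi * (ξ * u : ℝ) * Complex.I) * g ξ := by
  let χ : ContDiffBump (0 : ℝ) := ⟨1, 2, one_pos, one_lt_two⟩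
  let h : ℝ → ℂ := fun u => ((χ u * f u : ℝ) : ℂ)
  have hc : ContDiff ℝ A h := Complex.ofRealCLM.contDiff.comp (χ.contDiff.mul hsmooth)
  have hs : HasCompactSupport h :=
    (χ.hasCompactSupport.mul_right (f' := f)).comp_left (g := fun x : ℝ => (x : ℂ))
      Complex.ofReal_zero
  obtain ⟨G, hG, hb⟩ := norm_fourier_le_of_contDiff hc hs
  have hi : MeasureTheory.Integrable h := hc.continuous.integrable_of_hasCompactSupport hs
  have hcont : Continuous (𝓕 h) := VectorFourier.fourierIntegral_continuous
    Real.continuous_fourierChar (innerSL ℝ).continuous₂ hi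
  refine ⟨𝓕 h, G, hG, hcont, hb, ?_⟩
  intro u hu
  have hgi : MeasureTheory.Integrable (𝓕 h) :=
    ((integrable_inv_one_add_abs_pow hA2).const_mul G).mono' hcont.aestronglyMeasurable
      (Filter.Eventually.of_forall hb)
  have e : h u = f u := by
    simp only [h]
    rcases le_or_gt u 1 with h1 | h1
    · rw [χ.one_of_mem_closedBall, one_mul]
      rw [Metric.mem_closedBall, Real.dist_eq, sub_zero, abs_of_nonneg hu]
      exact h1
    · rw [hsupp u h1, mul_zero]
  rw [← e, ← hi.fourierInv_fourier_eq hgi hc.continuous.continuousAt, Real.fourierInv_eq']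
  refine MeasureTheory.integral_congr_ae (Filter.Eventually.of_forall fun ξ => ?_)
  simp only [smul_eq_mul]
  congr 3
  simp [mul_comm, mul_assoc]

/-- Only the divisors composed of primes up to `R` contribute to `Mf`. -/
theorem Mf_eq_sum_divisors {f : ℝ → ℝ} (hsupp : ∀ t : ℝ, 1 < t → f t = 0) {R : ℝ} (hR : 2 ≤ R)
    {n : ℕ} (hn : n ≠ 0) :
    Mf f n R = ∑ d ∈ (∏ p ∈ n.primeFactors with ((p : ℕ) : ℝ) ≤ R, p).divisors,
      ((ArithmeticFunction.moebius d : ℤ) : ℝ) * f (Real.log d / Real.log R) := by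
  unfold Mf
  symm
  apply Finset.sum_subset
  · exact Nat.divisors_subset_of_dvd hn
      ((Finset.prod_dvd_prod_of_subset _ _ _ (Finset.filter_subset _ _)).trans
        (Nat.prod_primeFactors_dvd n))
  · intro d hd hd'
    by_cases hsq : Squarefree d
    · have hd0 : d ≠ 0 := hsq.ne_zero
      have hex : ∃ p ∈ d.primeFactors, R < p := by
        by_contra! hcon
        apply hd'
        rw [Nat.mem_divisors]
        constructor
        · rw [← Nat.prod_primeFactors_of_squarefree hsq]
          refine Finset.prod_dvd_prod_of_subset _ _ _ fun p hp => ?_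
          exact Finset.mem_filter.2 ⟨Nat.primeFactors_mono (Nat.dvd_of_mem_divisors hd) hn hp,
            hcon p hp⟩
        · exact Finset.prod_ne_zero_iff.2 fun p hp =>
            (Nat.prime_of_mem_primeFactors (Finset.mem_filter.1 hp).1).ne_zero
      obtain ⟨p, hp, hRp⟩ := hex
      have hpd : (p : ℝ) ≤ d := by
        exact_mod_cast Nat.le_of_dvd (Nat.pos_of_ne_zero hd0) (Nat.dvd_of_mem_primeFactors hp)
      rw [hsupp, mul_zero]
      rw [one_lt_div (Real.log_pos (by linarith))]
      exact Real.log_lt_log (by linarith) (by linarith)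
    · rw [ArithmeticFunction.moebius_eq_zero_of_not_squarefree hsq]
      simp

theorem sum_moebius_mul_exp_log {N : ℕ} (hN : Squarefree N) (y : ℝ) :
    ∑ d ∈ N.divisors, ((ArithmeticFunction.moebius d : ℤ) : ℂ) *
      Complex.exp (Complex.I * ((y * Real.log d : ℝ) : ℂ)) =
    ∏ p ∈ N.primeFactors, (1 - Complex.exp (Complex.I * ((y * Real.log p : ℝ) : ℂ))) := by
  let F : ArithmeticFunction ℂ :=
    ⟨fun d => if d = 0 then 0 else Complex.exp (Complex.I * ((y * Real.log d : ℝ) : ℂ)), by simp⟩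
  have hF0 : ∀ d : ℕ, d ≠ 0 → F d = Complex.exp (Complex.I * ((y * Real.log d : ℝ) : ℂ)) :=
    fun d hd => if_neg hd
  have hF : F.IsMultiplicative := by
    refine ArithmeticFunction.IsMultiplicative.iff_ne_zero.2 ⟨?_, ?_⟩
    · rw [hF0 1 one_ne_zero]; simp
    · intro m n hm hn _
      rw [hF0 _ (mul_ne_zero hm hn), hF0 _ hm, hF0 _ hn, ← Complex.exp_add]
      rw [Nat.cast_mul, Real.log_mul (by exact_mod_cast hm) (by exact_mod_cast hn), mul_add,
        Complex.ofReal_add, mul_add]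
  have h := ArithmeticFunction.IsMultiplicative.prodPrimeFactors_one_sub_of_squarefree F hF hN
  rw [Finset.prod_congr rfl fun p hp => by
    rw [hF0 p (Nat.prime_of_mem_primeFactors hp).ne_zero]] at h
  rw [h]
  refine Finset.sum_congr rfl fun d hd => ?_
  rw [hF0 d (Nat.pos_of_mem_divisors hd).ne']

theorem norm_prod_one_sub_exp (R : ℝ) (n : ℕ) (y : ℝ) :
    ‖∏ p ∈ n.primeFactors with ((p : ℕ) : ℝ) ≤ R,
      (1 - Complex.exp (Complex.I * ((y * Real.log p : ℝ) : ℂ)))‖ = sinProd R n y := by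
  rw [sinProd, norm_prod]
  refine Finset.prod_congr rfl fun p _ => ?_
  rw [norm_sub_rev, Complex.norm_exp_I_mul_ofReal_sub_one, Real.norm_eq_abs, abs_mul, abs_two]

theorem sinProd_abs (R : ℝ) (n : ℕ) (t : ℝ) : sinProd R n |t| = sinProd R n t := by
  unfold sinProd
  refine Finset.prod_congr rfl fun p _ => ?_
  rcases abs_choice t with h | h
  · rw [h]
  · rw [h, neg_mul, neg_div, Real.sin_neg, abs_neg]

open MeasureTheory in
/-- `Mf` is dominated by an integral of `sinProd` against a decaying weight. -/
theorem exists_ofReal_abs_Mf_le {A : ℕ} (hA2 : 2 ≤ A) {f : ℝ → ℝ}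
    (hsupp : ∀ t : ℝ, 1 < t → f t = 0) (hsmooth : ContDiff ℝ A f) :
    ∃ G : ℝ, 0 < G ∧ ∀ (n : ℕ) (R : ℝ), n ≠ 0 → 2 ≤ R →
      ENNReal.ofReal |Mf f n R| ≤ ∫⁻ ξ in Set.Ioi (0 : ℝ), ENNReal.ofReal (G * ((1 + ξ) ^ A)⁻¹ *
        sinProd R n (2 * Real.pi * ξ / Real.log R)) := by
  obtain ⟨g, G, hG, hcont, hb, hrep⟩ := exists_fourier_density hA2 hsupp hsmooth
  refine ⟨2 * G, by positivity, ?_⟩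
  intro n R hn hR
  have hL : 0 < Real.log R := Real.log_pos (by linarith)
  set N := ∏ p ∈ n.primeFactors with ((p : ℕ) : ℝ) ≤ R, p with hNdef
  have hpr : ∀ p ∈ n.primeFactors.filter fun p => ((p : ℕ) : ℝ) ≤ R, p.Prime := fun p hp =>
    Nat.prime_of_mem_primeFactors (Finset.mem_filter.1 hp).1
  have hNsq : Squarefree N := by
    refine Finset.squarefree_prod_of_pairwise_isCoprime (fun p hp q hq hpq => ?_)
      fun p hp => (hpr p hp).squarefree
    simp only [Function.onFun, ← Nat.coprime_iff_isRelPrime]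
    exact (Nat.coprime_primes (hpr p hp) (hpr q hq)).2 hpq
  have hNpf : N.primeFactors = n.primeFactors.filter fun p => ((p : ℕ) : ℝ) ≤ R :=
    Nat.primeFactors_prod hpr
  have hgi : Integrable g :=
    ((integrable_inv_one_add_abs_pow hA2).const_mul G).mono' hcont.aestronglyMeasurable
      (Filter.Eventually.of_forall hb)
  have hei : ∀ u : ℝ, Integrable fun ξ : ℝ =>
      Complex.exp (2 * Real.pi * (ξ * u : ℝ) * Complex.I) * g ξ := by
    intro u
    refine hgi.mono (by fun_prop) (Filter.Eventually.of_forall fun ξ => ?_)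
    rw [norm_mul]
    have : (2 * Real.pi * (ξ * u : ℝ) * Complex.I : ℂ) =
        ((2 * Real.pi * (ξ * u) : ℝ) : ℂ) * Complex.I := by push_cast; ring
    rw [this, Complex.norm_exp_ofReal_mul_I, one_mul]
  have e1 : ((Mf f n R : ℝ) : ℂ) = ∫ ξ : ℝ, (∏ p ∈ n.primeFactors with ((p : ℕ) : ℝ) ≤ R,
      (1 - Complex.exp (Complex.I * ((2 * Real.pi * ξ / Real.log R * Real.log p : ℝ) : ℂ)))) *
      g ξ := by
    rw [Mf_eq_sum_divisors hsupp hR hn, ← hNdef]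
    simp_rw [← hNpf, ← sum_moebius_mul_exp_log hNsq, Finset.sum_mul]
    rw [integral_finsetSum]
    · push_cast
      refine Finset.sum_congr rfl fun d hd => ?_
      have hd1 : (1 : ℝ) ≤ d := by exact_mod_cast Nat.pos_of_mem_divisors hd
      have := hrep (Real.log d / Real.log R) (div_nonneg (Real.log_nonneg hd1) hL.le)
      push_cast at this
      rw [this, ← integral_const_mul]
      refine integral_congr_ae (Filter.Eventually.of_forall fun ξ => ?_)
      dsimp only
      rw [← mul_assoc]
      congr 3
      ring
    · intro d _
      refine ((hei (Real.log d / Real.log R)).const_mul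
        ((ArithmeticFunction.moebius d : ℤ) : ℂ)).congr
        (Filter.Eventually.of_forall fun ξ => ?_)
      dsimp only
      rw [← mul_assoc]
      congr 3
      push_cast
      ring
  have hcs : Continuous fun ξ : ℝ => sinProd R n (2 * Real.pi * ξ / Real.log R) :=
    (continuous_sinProd R n).comp (by fun_prop)
  let Φ : ℝ → ℝ := fun ξ => G * ((1 + ξ) ^ A)⁻¹ * sinProd R n (2 * Real.pi * ξ / Real.log R)
  have hΦabs : ∀ ξ : ℝ, Φ |ξ| = G * ((1 + |ξ|) ^ A)⁻¹ *
      sinProd R n (2 * Real.pi * ξ / Real.log R) := by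
    intro ξ
    simp only [Φ]
    rw [← sinProd_abs R n (2 * Real.pi * ξ / Real.log R), abs_div, abs_mul,
      abs_of_pos (by positivity : 0 < 2 * Real.pi), abs_of_pos hL]
  have hbound : ∀ ξ, sinProd R n ξ ≤ 2 ^ n.primeFactors.card := by
    intro ξ
    unfold sinProd
    calc _ ≤ ∏ p ∈ n.primeFactors with ((p : ℕ) : ℝ) ≤ R, (2 : ℝ) := by
          refine Finset.prod_le_prod (fun p _ => by positivity) fun p _ => ?_
          linarith [Real.abs_sin_le_one (ξ * Real.log p / 2)]
      _ = 2 ^ (n.primeFactors.filter fun p => ((p : ℕ) : ℝ) ≤ R).card := by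
          rw [Finset.prod_const]
      _ ≤ 2 ^ n.primeFactors.card :=
          pow_le_pow_right₀ one_le_two (Finset.card_filter_le _ _)
  have hΦi : Integrable fun ξ => Φ |ξ| := by
    simp only [hΦabs]
    refine (((integrable_inv_one_add_abs_pow hA2).const_mul G).mul_const
      (2 ^ n.primeFactors.card)).mono' ?_ (Filter.Eventually.of_forall fun ξ => ?_)
    · refine Continuous.aestronglyMeasurable (Continuous.mul (continuous_const.mul
        (Continuous.inv₀ (by fun_prop) fun ξ => by positivity)) hcs)
    · rw [Real.norm_of_nonneg (mul_nonneg (by positivity) (sinProd_nonneg _ _ _))]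
      exact mul_le_mul_of_nonneg_left (hbound _) (by positivity)
  have e3 : |Mf f n R| ≤ ∫ ξ, Φ |ξ| := by
    rw [← Real.norm_eq_abs, ← Complex.norm_real, e1]
    refine norm_integral_le_of_norm_le hΦi (Filter.Eventually.of_forall fun ξ => ?_)
    rw [norm_mul, norm_prod_one_sub_exp, hΦabs, mul_comm]
    exact mul_le_mul_of_nonneg_right (hb ξ) (sinProd_nonneg _ _ _)
  rw [integral_comp_abs] at e3
  have hΦpos : ∀ ξ, 0 ≤ ξ → 0 ≤ Φ ξ := fun ξ hξ =>
    mul_nonneg (by positivity) (sinProd_nonneg _ _ _)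
  have hΦi' : IntegrableOn Φ (Set.Ioi 0) := by
    refine hΦi.integrableOn.congr_fun (fun ξ hξ => ?_) measurableSet_Ioi
    simp only [abs_of_pos (Set.mem_Ioi.1 hξ)]
  have e4 : (∫ ξ in Set.Ioi (0 : ℝ), 2 * Φ ξ) = 2 * ∫ ξ in Set.Ioi (0 : ℝ), Φ ξ :=
    integral_const_mul _ _
  rw [← e4] at e3
  refine (ENNReal.ofReal_le_ofReal e3).trans ?_
  rw [ofReal_integral_eq_lintegral_ofReal (hΦi'.const_mul 2)]
  · refine lintegral_mono fun ξ => ENNReal.ofReal_le_ofReal (le_of_eq ?_)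
    simp only [Φ]
    ring
  · refine (ae_restrict_iff' measurableSet_Ioi).2 (Filter.Eventually.of_forall fun ξ hξ => ?_)
    have := hΦpos ξ (Set.mem_Ioi.1 hξ).le
    simp only [Pi.zero_apply]
    positivity

theorem two_mul_add_three_mul_four_thirds_le {s : ℕ} (hs : 1 ≤ s) :
    (4 / 3 : ℝ) * (2 * s + 3) ≤ ((2 * (2 * (s + 1)).choose (s + 2) : ℕ) : ℝ) := by
  have h : ∀ j : ℕ, j ≤ s → 2 * (s + 1) ≤ (2 * (s + 1)).choose (j + 1) := by
    intro j
    induction j with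
    | zero => intro _; simp
    | succ j ih =>
      intro hj
      exact (ih (by omega)).trans (Nat.choose_le_succ_of_lt_half_left (by omega))
  have h1 := h (s - 1) (by omega)
  rw [show s - 1 + 1 = s by omega] at h1
  rw [Nat.choose_symm_of_eq_add (show 2 * (s + 1) = s + 2 + s by ring)]
  have h2 : (2 * ((s : ℝ) + 1)) ≤ ((2 * (s + 1)).choose s : ℕ) := by exact_mod_cast h1
  push_cast
  have : (0 : ℝ) ≤ s := Nat.cast_nonneg s
  linarith

open MeasureTheory in
theorem setLIntegral_rpow_neg_four_thirds_le :
    ∃ c : ℝ, 0 < c ∧ ∀ L a : ℝ, 1 / 2 ≤ L → 0 < a → ∀ ξ : ℝ,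
      ∫⁻ η in Set.Ico (L / (2 * Real.pi) * a) (L / (2 * Real.pi) * (3 / 2 * a)),
        ENNReal.ofReal ((1 + L * min |2 * Real.pi * ξ / L - 2 * Real.pi * η / L| 1) ^
          (-(4 / 3) : ℝ)) ≤ ENNReal.ofReal (c * (1 + a)) := by
  have hi : Integrable fun η : ℝ => (1 + ‖η‖) ^ (-(4 / 3) : ℝ) :=
    integrable_one_add_norm (by rw [Module.finrank_self]; norm_num)
  set I := ∫ η : ℝ, (1 + ‖η‖) ^ (-(4 / 3) : ℝ) with hI
  have hI0 : 0 ≤ I := integral_nonneg fun η => by positivity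
  refine ⟨I + 1, by positivity, ?_⟩
  intro L a hL ha ξ
  have hL0 : 0 < L := by linarith
  have hpi := Real.pi_gt_three
  have hpt : ∀ η : ℝ, ENNReal.ofReal
      ((1 + L * min |2 * Real.pi * ξ / L - 2 * Real.pi * η / L| 1) ^ (-(4 / 3) : ℝ)) ≤
      ENNReal.ofReal ((1 + ‖η - ξ‖) ^ (-(4 / 3) : ℝ)) + ENNReal.ofReal (L ^ (-1 : ℝ)) := by
    intro η
    rcases min_choice |2 * Real.pi * ξ / L - 2 * Real.pi * η / L| 1 with h | h
    · refine le_add_right (ENNReal.ofReal_le_ofReal ?_)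
      rw [h]
      refine Real.rpow_le_rpow_of_nonpos (by positivity) ?_ (by norm_num)
      have : L * |2 * Real.pi * ξ / L - 2 * Real.pi * η / L| = 2 * Real.pi * ‖η - ξ‖ := by
        rw [← sub_div, abs_div, abs_of_pos hL0, mul_div_cancel₀ _ hL0.ne', ← mul_sub, abs_mul,
          abs_of_pos (by positivity), Real.norm_eq_abs, abs_sub_comm]
      rw [this]
      nlinarith [norm_nonneg (η - ξ)]
    · refine le_add_left (ENNReal.ofReal_le_ofReal ?_)
      rw [h, mul_one]
      calc (1 + L) ^ (-(4 / 3) : ℝ) ≤ (1 + L) ^ (-1 : ℝ) :=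
            Real.rpow_le_rpow_of_exponent_le (by linarith) (by norm_num)
        _ ≤ L ^ (-1 : ℝ) := Real.rpow_le_rpow_of_nonpos hL0 (by linarith) (by norm_num)
  refine (lintegral_mono hpt).trans ?_
  rw [lintegral_add_right _ measurable_const, lintegral_const, Measure.restrict_apply_univ,
    Real.volume_Ico]
  have e1 : ∫⁻ η, ENNReal.ofReal ((1 + ‖η - ξ‖) ^ (-(4 / 3) : ℝ)) = ENNReal.ofReal I := by
    rw [lintegral_sub_right_eq_self (fun η : ℝ => ENNReal.ofReal ((1 + ‖η‖) ^ (-(4 / 3) : ℝ))) ξ,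
      hI, ofReal_integral_eq_lintegral_ofReal hi (Filter.Eventually.of_forall fun η => by
        simp only [Pi.zero_apply]; positivity)]
  refine (add_le_add ((setLIntegral_le_lintegral _ _).trans e1.le) le_rfl).trans ?_
  rw [← ENNReal.ofReal_mul (by positivity), ← ENNReal.ofReal_add hI0 (by
    rw [show L / (2 * Real.pi) * (3 / 2 * a) - L / (2 * Real.pi) * a =
      L / (2 * Real.pi) * (a / 2) by ring]; positivity)]
  refine ENNReal.ofReal_le_ofReal ?_
  rw [Real.rpow_neg_one, show L⁻¹ * (L / (2 * Real.pi) * (3 / 2 * a) - L / (2 * Real.pi) * a) =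
    a / (4 * Real.pi) by field_simp; ring]
  have : a / (4 * Real.pi) ≤ a := div_le_self ha.le (by linarith)
  nlinarith

open MeasureTheory in
/-- Moment bound for `sinProd` integrated over one dyadic-type block of frequencies. -/
theorem exists_sum_setLIntegral_sinProd_pow_le {s : ℕ} (hs : 1 ≤ s) :
    ∃ M : ℝ, 0 < M ∧ ∀ x R a : ℝ, 2 ≤ R → R ≤ x → 0 < a →
      ∑ n ∈ Finset.Icc 1 ⌊x⌋₊,
        (∫⁻ ξ in Set.Ico (Real.log R / (2 * Real.pi) * a)
          (Real.log R / (2 * Real.pi) * (3 / 2 * a)),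
          ENNReal.ofReal (sinProd R n (2 * Real.pi * ξ / Real.log R))) ^ (2 * (s + 2)) ≤
      ENNReal.ofReal (M * (x * a * (1 + a) ^ (2 * (s + 2)) *
        (1 + Real.log R * min a 1) ^ Nat.centralBinom (s + 2))) := by
  obtain ⟨K, hK, hcorr⟩ := exists_sum_sinProd_sq_mul_pow_le s
  obtain ⟨c, hc, hV⟩ := setLIntegral_rpow_neg_four_thirds_le
  refine ⟨K * c ^ (2 * s + 3), by positivity, ?_⟩
  intro x R a hR hRx ha
  have hx : 0 < x := by linarith
  have hL : 1 / 2 ≤ Real.log R := by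
    have := Real.log_two_gt_d9
    have := Real.log_le_log (by norm_num) hR
    linarith
  have hpi := Real.pi_gt_three
  set L := Real.log R
  have hL0 : 0 < L := by linarith
  set J := Set.Ico (L / (2 * Real.pi) * a) (L / (2 * Real.pi) * (3 / 2 * a)) with hJ
  have hJm : MeasurableSet J := measurableSet_Ico
  let W : ℝ → ℝ → ℝ := fun ξ η => 1 + L * min |2 * Real.pi * ξ / L - 2 * Real.pi * η / L| 1
  have hW : ∀ ξ η, 1 ≤ W ξ η := fun ξ η => le_add_of_nonneg_right
    (mul_nonneg hL0.le (le_min (abs_nonneg _) zero_le_one))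
  have hW0 : ∀ ξ η, 0 < W ξ η := fun ξ η => zero_lt_one.trans_le (hW ξ η)
  have hmin : 0 ≤ min a 1 := le_min ha.le zero_le_one
  let X : ℕ → ℝ → ENNReal := fun n => J.indicator fun ξ =>
    ENNReal.ofReal (sinProd R n (2 * Real.pi * ξ / L))
  have hX : ∀ n, Measurable (X n) := fun n => Measurable.indicator
    (((continuous_sinProd R n).comp (by fun_prop)).measurable.ennreal_ofReal) hJm
  set P := K * (x / L * (1 + a) * (1 + L * min a 1) ^ Nat.centralBinom (s + 2)) with hP
  have hP0 : 0 ≤ P := by positivity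
  have hpow : ∀ ξ η, (W ξ η ^ (-(2 / 3) : ℝ)) ^ 2 = W ξ η ^ (-(4 / 3) : ℝ) := by
    intro ξ η
    rw [← Real.rpow_natCast, ← Real.rpow_mul (hW0 ξ η).le]
    norm_num
  have hmain := sum_lintegral_pow_le (μ := volume.restrict J) (Finset.Icc 1 ⌊x⌋₊) hX (2 * s + 1)
    (V := fun ξ η => ENNReal.ofReal (W ξ η ^ (-(2 / 3) : ℝ))) (κ := ENNReal.ofReal P)
    (B := ENNReal.ofReal (c * (1 + a)))
    (by simp only [W, Function.uncurry_def]; fun_prop)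
    (fun ξ η => (ENNReal.ofReal_pos.2 (Real.rpow_pos_of_pos (hW0 ξ η) _)).ne')
    (fun ξ η => ENNReal.ofReal_ne_top)
    (fun ξ η => by simp only [W]; rw [abs_sub_comm]) ?_ ?_
  · have e1 : ∀ n, ∫⁻ ξ in J, X n ξ =
        ∫⁻ ξ in J, ENNReal.ofReal (sinProd R n (2 * Real.pi * ξ / L)) := fun n => by
      rw [setLIntegral_indicator hJm, Set.inter_self]
    simp only [e1] at hmain
    refine hmain.trans ?_
    rw [Measure.restrict_apply_univ, hJ, Real.volume_Ico, ← ENNReal.ofReal_pow (by positivity),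
      ← ENNReal.ofReal_mul hP0, ← ENNReal.ofReal_mul (by positivity)]
    refine ENNReal.ofReal_le_ofReal ?_
    have e2 : P * (c * (1 + a)) ^ (2 * s + 1 + 2) *
        (L / (2 * Real.pi) * (3 / 2 * a) - L / (2 * Real.pi) * a) =
        K * c ^ (2 * s + 3) * (x * a * (1 + a) ^ (2 * (s + 2)) *
        (1 + L * min a 1) ^ Nat.centralBinom (s + 2)) / (4 * Real.pi) := by
      rw [hP, mul_pow c]
      field_simp
      ring
    rw [e2]
    exact div_le_self (by positivity) (by linarith)
  · intro ξ η
    by_cases hξ : ξ ∈ J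
    · by_cases hη : η ∈ J
      · have hrange : ∀ ζ ∈ J, a ≤ 2 * Real.pi * ζ / L ∧ 2 * Real.pi * ζ / L ≤ 3 / 2 * a := by
          intro ζ hζ
          obtain ⟨h1, h2⟩ := hζ
          rw [div_mul_eq_mul_div, div_le_iff₀ (by positivity)] at h1
          rw [div_mul_eq_mul_div, lt_div_iff₀ (by positivity)] at h2
          rw [le_div_iff₀ hL0, div_le_iff₀ hL0]
          constructor <;> linarith
        have h := hcorr x R a (2 * Real.pi * ξ / L) (2 * Real.pi * η / L) hR hRx ha
          (hrange ξ hξ).1 (hrange ξ hξ).2 (hrange η hη).1 (hrange η hη).2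
        have e1 : ∀ n, X n ξ ^ 2 * X n η ^ (2 * s + 1 + 1) = ENNReal.ofReal
            (sinProd R n (2 * Real.pi * ξ / L) ^ 2 *
              sinProd R n (2 * Real.pi * η / L) ^ (2 * (s + 1))) := by
          intro n
          simp only [X, Set.indicator_of_mem hξ, Set.indicator_of_mem hη]
          rw [← ENNReal.ofReal_pow (sinProd_nonneg _ _ _),
            ← ENNReal.ofReal_pow (sinProd_nonneg _ _ _),
            ← ENNReal.ofReal_mul (pow_nonneg (sinProd_nonneg _ _ _) _)]
          rfl
        simp only [e1]
        rw [← ENNReal.ofReal_sum_of_nonneg fun n _ => mul_nonneg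
          (pow_nonneg (sinProd_nonneg _ _ _) _) (pow_nonneg (sinProd_nonneg _ _ _) _),
          ← ENNReal.ofReal_pow (Real.rpow_nonneg (hW0 ξ η).le _), ← ENNReal.ofReal_mul hP0]
        refine ENNReal.ofReal_le_ofReal (h.trans ?_)
        have e3 : (W ξ η ^ (-(2 / 3) : ℝ)) ^ (2 * (2 * s + 1 + 2)) =
            (W ξ η ^ (-(4 / 3) : ℝ)) ^ (2 * s + 3) := by rw [pow_mul, hpow]
        rw [e3, hP, ← mul_assoc]
        refine mul_le_mul_of_nonneg_left ?_ (by positivity)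
        change (W ξ η ^ (2 * (2 * (s + 1)).choose (s + 2)))⁻¹ ≤ _
        rw [← Real.rpow_natCast, ← Real.rpow_natCast, ← Real.rpow_neg (hW0 ξ η).le,
          ← Real.rpow_mul (hW0 ξ η).le]
        refine Real.rpow_le_rpow_of_exponent_le (hW ξ η) ?_
        have := two_mul_add_three_mul_four_thirds_le hs
        push_cast at this ⊢
        linarith
      · simp [X, Set.indicator_of_notMem hη]
    · simp [X, Set.indicator_of_notMem hξ]
  · intro ξ
    refine le_trans (le_of_eq ?_) (hV L a hL ha ξ)
    refine lintegral_congr fun η => ?_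
    rw [← ENNReal.ofReal_pow (Real.rpow_nonneg (hW0 ξ η).le _), hpow]

/-- Minkowski-type bound: summing over blocks with prescribed geometric-type sizes. -/
theorem sum_tsum_pow_succ_le {ι κ : Type*} (S : Finset ι) (Y : ι → κ → ENNReal) (m : ℕ)
    {ω : κ → ENNReal} (h0 : ∀ i, ω i ≠ 0) (htop : ∀ i, ω i ≠ ⊤) {Q : ENNReal}
    (hY : ∀ i, ∑ n ∈ S, Y n i ^ (m + 1) ≤ Q * ω i ^ (m + 1)) :
    ∑ n ∈ S, (∑' i, Y n i) ^ (m + 1) ≤ Q * (∑' i, ω i) ^ (m + 1) := by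
  let _ : MeasurableSpace κ := ⊤
  have h1 : ∀ n, (∑' i, Y n i) ^ (m + 1) ≤
      (∑' i, ω i) ^ m * ∑' i, Y n i ^ (m + 1) * (ω i ^ m)⁻¹ := by
    intro n
    simpa only [MeasureTheory.lintegral_count] using lintegral_pow_succ_le
      (μ := MeasureTheory.Measure.count) m (F := Y n) (W := ω) measurable_from_top
      measurable_from_top h0 htop
  refine (Finset.sum_le_sum fun n _ => h1 n).trans ?_
  rw [← Finset.mul_sum, ← Summable.tsum_finsetSum fun _ _ => ENNReal.summable]
  have h2 : ∀ i, ∑ n ∈ S, Y n i ^ (m + 1) * (ω i ^ m)⁻¹ ≤ Q * ω i := by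
    intro i
    rw [← Finset.sum_mul]
    refine (mul_le_mul' (hY i) le_rfl).trans (le_of_eq ?_)
    rw [pow_succ', ← mul_assoc, mul_assoc, ENNReal.mul_inv_cancel (pow_ne_zero _ (h0 i))
      (ENNReal.pow_ne_top (htop i)), mul_one]
  refine (mul_le_mul' le_rfl (ENNReal.tsum_le_tsum h2)).trans (le_of_eq ?_)
  rw [ENNReal.tsum_mul_left]
  ring

theorem block_weight_le {q A C : ℕ} (hq : 2 ≤ q) (hA : 2 ≤ A) (hC : q * A ≤ C) {L a : ℝ}
    (hL : 1 / 2 ≤ L) (ha : 0 < a) :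
    a * (1 + a) ^ q * (1 + L * min a 1) ^ C * (((1 + L / (2 * Real.pi) * a) ^ A)⁻¹) ^ q ≤
      2 ^ q * 3 ^ C * (2 * Real.pi) ^ (q * A) * L ^ (C - q * A) * min a a⁻¹ := by
  obtain ⟨e, rfl⟩ := Nat.exists_eq_add_of_le hC
  rw [Nat.add_sub_cancel_left, inv_pow, ← pow_mul, mul_comm A q, ← div_eq_mul_inv,
    div_le_iff₀ (by have := Real.pi_pos; positivity)]
  have hpi := Real.pi_gt_three
  have hL0 : 0 < L := by linarith
  rcases le_total a 1 with h | h
  · rw [min_eq_left h, min_eq_left (h.trans ((one_le_inv₀ ha).2 h))]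
    have h1 : (1 + a) ^ q ≤ 2 ^ q := by gcongr; linarith
    have h2 : (1 + L * a) ^ e ≤ 3 ^ e * L ^ e := by
      rw [← mul_pow]
      gcongr
      nlinarith
    have h3 : (1 + L * a) ^ (q * A) ≤
        (2 * Real.pi) ^ (q * A) * (1 + L / (2 * Real.pi) * a) ^ (q * A) := by
      rw [← mul_pow]
      gcongr
      have : 2 * Real.pi * (1 + L / (2 * Real.pi) * a) = 2 * Real.pi + L * a := by field_simp
      linarith
    have h4 : (3 : ℝ) ^ e ≤ 3 ^ (q * A + e) := pow_le_pow_right₀ (by norm_num) (by omega)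
    calc a * (1 + a) ^ q * (1 + L * a) ^ (q * A + e)
        = a * (1 + a) ^ q * ((1 + L * a) ^ (q * A) * (1 + L * a) ^ e) := by rw [pow_add]
      _ ≤ a * 2 ^ q * (((2 * Real.pi) ^ (q * A) * (1 + L / (2 * Real.pi) * a) ^ (q * A)) *
          (3 ^ (q * A + e) * L ^ e)) := by
          gcongr
          exact h2.trans (by gcongr)
      _ = _ := by ring
  · rw [min_eq_right h, min_eq_right ((inv_le_one_of_one_le₀ h).trans h), mul_one]
    have h1 : (1 + a) ^ q ≤ 2 ^ q * a ^ q := by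
      rw [← mul_pow]
      gcongr
      linarith
    have h2 : (1 + L) ^ (q * A + e) ≤ 3 ^ (q * A + e) * (L ^ (q * A) * L ^ e) := by
      rw [← pow_add, ← mul_pow]
      gcongr
      linarith
    have h3 : L ^ (q * A) * a ^ (q * A) ≤
        (2 * Real.pi) ^ (q * A) * (1 + L / (2 * Real.pi) * a) ^ (q * A) := by
      rw [← mul_pow, ← mul_pow]
      refine pow_le_pow_left₀ (by positivity) ?_ _
      have : 2 * Real.pi * (1 + L / (2 * Real.pi) * a) = 2 * Real.pi + L * a := by field_simp
      linarith
    have h4 : a * a ^ q ≤ a⁻¹ * a ^ (q * A) := by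
      rw [inv_mul_eq_div, le_div_iff₀ ha, ← pow_succ', ← pow_succ]
      exact pow_le_pow_right₀ h (by nlinarith)
    calc a * (1 + a) ^ q * (1 + L) ^ (q * A + e)
        ≤ a * (2 ^ q * a ^ q) * (3 ^ (q * A + e) * (L ^ (q * A) * L ^ e)) := by gcongr
      _ = 2 ^ q * 3 ^ (q * A + e) * L ^ e * (a * a ^ q * L ^ (q * A)) := by ring
      _ ≤ 2 ^ q * 3 ^ (q * A + e) * L ^ e * (a⁻¹ * a ^ (q * A) * L ^ (q * A)) := by gcongr
      _ = 2 ^ q * 3 ^ (q * A + e) * L ^ e * a⁻¹ * (L ^ (q * A) * a ^ (q * A)) := by ring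
      _ ≤ 2 ^ q * 3 ^ (q * A + e) * L ^ e * a⁻¹ *
          ((2 * Real.pi) ^ (q * A) * (1 + L / (2 * Real.pi) * a) ^ (q * A)) := by gcongr
      _ = _ := by ring

theorem min_zpow_le_two_thirds_pow (i : ℤ) :
    min ((3 / 2 : ℝ) ^ i) ((3 / 2 : ℝ) ^ i)⁻¹ ≤ (2 / 3) ^ i.natAbs := by
  rcases Int.natAbs_eq i with h | h
  · refine (min_le_right _ _).trans (le_of_eq ?_)
    conv_lhs => rw [h]
    rw [zpow_natCast, ← inv_pow]
    norm_num
  · refine (min_le_left _ _).trans (le_of_eq ?_)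
    conv_lhs => rw [h]
    rw [zpow_neg, zpow_natCast, ← inv_pow]
    norm_num

theorem summable_pow_natAbs {β : ℝ} (h0 : 0 ≤ β) (h1 : β < 1) :
    Summable fun i : ℤ => β ^ i.natAbs := by
  refine Summable.of_nat_of_neg ?_ ?_ <;>
  simpa using summable_geometric_of_lt_one h0 h1

open MeasureTheory in
theorem lintegral_Ioi_le_tsum_blocks (Φ : ℝ → ENNReal) {b : ℝ} (hb : 0 < b) :
    ∫⁻ ξ in Set.Ioi (0 : ℝ), Φ ξ ≤
      ∑' i : ℤ, ∫⁻ ξ in Set.Ico (b * (3 / 2 : ℝ) ^ i) (b * (3 / 2 * (3 / 2 : ℝ) ^ i)), Φ ξ := by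
  refine (lintegral_mono_set ?_).trans (lintegral_iUnion_le _ _)
  intro ξ hξ
  obtain ⟨i, h1, h2⟩ := exists_mem_Ico_zpow (x := ξ / b) (y := 3 / 2) (div_pos hξ hb) (by norm_num)
  refine Set.mem_iUnion.2 ⟨i, ?_, ?_⟩
  · rw [mul_comm]; exact (le_div_iff₀ hb).1 h1
  · rw [zpow_add_one₀ (by norm_num), mul_comm _ (3 / 2 : ℝ)] at h2
    rw [mul_comm b]; exact (div_lt_iff₀ hb).1 h2

open MeasureTheory in
theorem exists_sum_block_pow_le {s A : ℕ} (hs : 1 ≤ s) (hA2 : 2 ≤ A)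
    (hA : 2 * (s + 2) * A ≤ Nat.centralBinom (s + 2)) {G : ℝ} (hG : 0 < G) :
    ∃ M : ℝ, 0 < M ∧ ∀ x R : ℝ, 2 ≤ R → R ≤ x → ∀ i : ℤ,
      ∑ n ∈ Finset.Icc 1 ⌊x⌋₊,
        (∫⁻ ξ in Set.Ico (Real.log R / (2 * Real.pi) * (3 / 2 : ℝ) ^ i)
          (Real.log R / (2 * Real.pi) * (3 / 2 * (3 / 2 : ℝ) ^ i)),
          ENNReal.ofReal (G * ((1 + ξ) ^ A)⁻¹ *
            sinProd R n (2 * Real.pi * ξ / Real.log R))) ^ (2 * (s + 2)) ≤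
      ENNReal.ofReal (M * x * Real.log R ^ (Nat.centralBinom (s + 2) - 2 * (s + 2) * A)) *
        ENNReal.ofReal ((2 / 3) ^ i.natAbs) := by
  obtain ⟨M, hM, h⟩ := exists_sum_setLIntegral_sinProd_pow_le hs
  have hpi := Real.pi_pos
  set q := 2 * (s + 2) with hq
  set C := Nat.centralBinom (s + 2)
  refine ⟨G ^ q * M * (2 ^ q * 3 ^ C * (2 * Real.pi) ^ (q * A)), by positivity, ?_⟩
  intro x R hR hRx i
  set a : ℝ := (3 / 2 : ℝ) ^ i with ha'
  have ha : 0 < a := by positivity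
  have hx : 0 < x := by linarith
  have hL : 1 / 2 ≤ Real.log R := by
    have := Real.log_two_gt_d9
    have := Real.log_le_log (by norm_num) hR
    linarith
  set L := Real.log R
  have hL0 : 0 < L := by linarith
  have hb0 : 0 < L / (2 * Real.pi) * a := by positivity
  have hmin : 0 ≤ min a 1 := le_min ha.le zero_le_one
  have h1 : ∀ n : ℕ, ∫⁻ ξ in Set.Ico (L / (2 * Real.pi) * a) (L / (2 * Real.pi) * (3 / 2 * a)),
      ENNReal.ofReal (G * ((1 + ξ) ^ A)⁻¹ * sinProd R n (2 * Real.pi * ξ / L)) ≤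
      ENNReal.ofReal (G * ((1 + L / (2 * Real.pi) * a) ^ A)⁻¹) *
        ∫⁻ ξ in Set.Ico (L / (2 * Real.pi) * a) (L / (2 * Real.pi) * (3 / 2 * a)),
          ENNReal.ofReal (sinProd R n (2 * Real.pi * ξ / L)) := by
    intro n
    have hm : Measurable fun ξ => ENNReal.ofReal (sinProd R n (2 * Real.pi * ξ / L)) :=
      ((continuous_sinProd R n).comp (by fun_prop)).measurable.ennreal_ofReal
    rw [← lintegral_const_mul _ hm]
    refine setLIntegral_mono (by fun_prop) fun ξ hξ => ?_
    rw [← ENNReal.ofReal_mul (by positivity)]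
    refine ENNReal.ofReal_le_ofReal (mul_le_mul_of_nonneg_right ?_ (sinProd_nonneg _ _ _))
    have := hξ.1
    gcongr
  refine (Finset.sum_le_sum fun n _ => pow_le_pow_left' (h1 n) q).trans ?_
  simp only [mul_pow (ENNReal.ofReal _)]
  rw [← Finset.mul_sum]
  refine (mul_le_mul' le_rfl (h x R a hR hRx ha)).trans ?_
  rw [← ENNReal.ofReal_pow (by positivity), ← ENNReal.ofReal_mul (by positivity),
    ← ENNReal.ofReal_mul (by positivity)]
  refine ENNReal.ofReal_le_ofReal ?_
  have h2 := block_weight_le (q := q) (A := A) (C := C) (by omega) hA2 hA hL ha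
  have h3 := min_zpow_le_two_thirds_pow i
  calc (G * ((1 + L / (2 * Real.pi) * a) ^ A)⁻¹) ^ q *
        (M * (x * a * (1 + a) ^ q * (1 + L * min a 1) ^ C))
      = G ^ q * M * x * (a * (1 + a) ^ q * (1 + L * min a 1) ^ C *
        (((1 + L / (2 * Real.pi) * a) ^ A)⁻¹) ^ q) := by rw [mul_pow]; ring
    _ ≤ G ^ q * M * x * (2 ^ q * 3 ^ C * (2 * Real.pi) ^ (q * A) * L ^ (C - q * A) *
        (2 / 3) ^ i.natAbs) := by
        refine mul_le_mul_of_nonneg_left (h2.trans ?_) (by positivity)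
        exact mul_le_mul_of_nonneg_left h3 (by positivity)
    _ = _ := by ring

theorem exists_sum_Mf_pow_le {s A : ℕ} (hs : 1 ≤ s) (hA2 : 2 ≤ A)
    (hA : 2 * (s + 2) * A ≤ Nat.centralBinom (s + 2)) {f : ℝ → ℝ}
    (hsupp : ∀ t : ℝ, 1 < t → f t = 0) (hsmooth : ContDiff ℝ A f) :
    ∃ C : ℝ, 0 < C ∧ ∀ x R : ℝ, 2 ≤ R → R ≤ x →
      ∑ n ∈ Finset.Icc 1 ⌊x⌋₊, Mf f n R ^ (2 * (s + 2)) ≤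
        C * x * Real.log R ^ (Nat.centralBinom (s + 2) - 2 * (s + 2) * A) := by
  obtain ⟨G, hG, hMf⟩ := exists_ofReal_abs_Mf_le hA2 hsupp hsmooth
  obtain ⟨M, hM, hblock⟩ := exists_sum_block_pow_le hs hA2 hA hG
  set q := 2 * (s + 2) with hq
  have hq0 : (q : ℝ) ≠ 0 := by rw [hq]; positivity
  set β : ℝ := (2 / 3 : ℝ) ^ (1 / (q : ℝ)) with hβ
  have hβ0 : 0 < β := by positivity
  have hβ1 : β < 1 := Real.rpow_lt_one (by norm_num) (by norm_num) (by positivity)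
  have hβq : β ^ q = 2 / 3 := by
    rw [hβ, ← Real.rpow_natCast, ← Real.rpow_mul (by norm_num), one_div_mul_cancel hq0,
      Real.rpow_one]
  have hsum := summable_pow_natAbs hβ0.le hβ1
  have hΩ0 : 0 ≤ ∑' i : ℤ, β ^ i.natAbs := tsum_nonneg fun i => by positivity
  refine ⟨M * (∑' i : ℤ, β ^ i.natAbs) ^ q + 1, by positivity, ?_⟩
  intro x R hR hRx
  have hx : 0 < x := by linarith
  have hL0 : 0 < Real.log R := Real.log_pos (by linarith)
  have hLpow : 0 < Real.log R ^ (Nat.centralBinom (s + 2) - q * A) := by positivity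
  have h1 : ∀ i : ℤ, ENNReal.ofReal (β ^ i.natAbs) ^ q = ENNReal.ofReal ((2 / 3) ^ i.natAbs) := by
    intro i
    rw [← ENNReal.ofReal_pow (by positivity), ← pow_mul, mul_comm, pow_mul, hβq]
  have h2 := sum_tsum_pow_succ_le (Finset.Icc 1 ⌊x⌋₊)
    (fun n (i : ℤ) => ∫⁻ ξ in Set.Ico (Real.log R / (2 * Real.pi) * (3 / 2 : ℝ) ^ i)
          (Real.log R / (2 * Real.pi) * (3 / 2 * (3 / 2 : ℝ) ^ i)),
          ENNReal.ofReal (G * ((1 + ξ) ^ A)⁻¹ *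
            sinProd R n (2 * Real.pi * ξ / Real.log R))) (q - 1)
    (ω := fun i => ENNReal.ofReal (β ^ i.natAbs))
    (Q := ENNReal.ofReal (M * x * Real.log R ^ (Nat.centralBinom (s + 2) - q * A)))
    (fun i => (ENNReal.ofReal_pos.2 (by positivity)).ne') (fun i => ENNReal.ofReal_ne_top) (by
      intro i
      rw [show q - 1 + 1 = q by omega, h1]
      exact hblock x R hR hRx i)
  rw [show q - 1 + 1 = q by omega] at h2
  have h3 : ∀ n ∈ Finset.Icc 1 ⌊x⌋₊, ENNReal.ofReal (Mf f n R ^ q) ≤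
      (∑' i : ℤ, ∫⁻ ξ in Set.Ico (Real.log R / (2 * Real.pi) * (3 / 2 : ℝ) ^ i)
          (Real.log R / (2 * Real.pi) * (3 / 2 * (3 / 2 : ℝ) ^ i)),
          ENNReal.ofReal (G * ((1 + ξ) ^ A)⁻¹ *
            sinProd R n (2 * Real.pi * ξ / Real.log R))) ^ q := by
    intro n hn
    have hn0 : n ≠ 0 := Nat.one_le_iff_ne_zero.1 (Finset.mem_Icc.1 hn).1
    have heven : Even q := ⟨s + 2, by omega⟩
    rw [← heven.pow_abs, ENNReal.ofReal_pow (abs_nonneg _)]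
    refine pow_le_pow_left' ((hMf n R hn0 hR).trans ?_) q
    exact lintegral_Ioi_le_tsum_blocks _ (by have := Real.pi_pos; positivity)
  have h4 := (Finset.sum_le_sum h3).trans h2
  rw [← ENNReal.ofReal_sum_of_nonneg fun n _ => (even_two_mul (s + 2)).pow_nonneg _,
    ← ENNReal.ofReal_tsum_of_nonneg (fun i => by positivity) hsum, ← ENNReal.ofReal_pow hΩ0,
    ← ENNReal.ofReal_mul (by positivity), ENNReal.ofReal_le_ofReal_iff (by positivity)] at h4
  refine h4.trans ?_
  nlinarith [mul_pos hx hLpow]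

/-- Let `k ≥ 1` and `A ≥ 2` with `A ≤ binom(2k,k)/(2k)`, and let `f` be supported on
`(−∞,1]`, of class `C^A` with `f, f′, …, f^{(A)}` uniformly bounded. Then there is
`C(k,f) > 0` such that for all `x ≥ R ≥ 2`,
`Σ_{n ≤ x} M_f(n;R)^{2k} ≤ C(k,f)·x·(log R)^{binom(2k,k) − 2kA}`. -/
theorem moment_smooth_upper_bound (k A : ℕ) (hk : 1 ≤ k) (hA2 : 2 ≤ A)
    (hA : 2 * k * A ≤ Nat.choose (2 * k) k)
    (f : ℝ → ℝ) (hsupp : ∀ t : ℝ, 1 < t → f t = 0)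
    (hsmooth : ContDiff ℝ A f)
    (hbdd : ∀ i ≤ A, ∃ B : ℝ, ∀ x : ℝ, |iteratedDeriv i f x| ≤ B) :
    ∃ C : ℝ, 0 < C ∧ ∀ x R : ℝ, 2 ≤ R → R ≤ x →
      ∑ n ∈ Finset.Icc 1 ⌊x⌋₊, Mf f n R ^ (2 * k) ≤
        C * x * Real.log R ^ ((Nat.choose (2 * k) k : ℤ) - ((2 * k * A : ℕ) : ℤ)) := by
  have hk3 : 3 ≤ k := by
    by_contra! hlt
    interval_cases k
    · norm_num at hA
      omega
    · rw [show Nat.choose (2 * 2) 2 = 6 by decide] at hA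
      omega
  obtain ⟨s, rfl⟩ := Nat.exists_eq_add_of_le' (show 2 ≤ k by omega)
  obtain ⟨C, hC, h⟩ := exists_sum_Mf_pow_le (s := s) (by omega) hA2 hA hsupp hsmooth
  refine ⟨C, hC, fun x R hR hRx => ?_⟩
  rw [← Nat.cast_sub hA, zpow_natCast]
  exact h x R hR hRx
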